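/- (Gradient comparison theorem) Let n ≥ 1, let Ω ⊂ ℝⁿ be a nonempty bounded open convex set with smooth boundary, and let F be a strongly convex Minkowski norm of class C³ on ℝⁿ∖{0}. Let λ > 0 and let u be a nonconstant Neumann eigenfunction of the Finsler–Laplacian on Ω with eigenvalue λ and ∫_Ω u dx = 0. Let a < b (with a > 0 if T(t) = −(n−1)/t) and let v : [a,b] → ℝ be a C² solution of the one-dimensional model v''(t) − T(t) v'(t) = −λ v(t) on (a,b) with v'(a) = v'(b) = 0 and v' > 0 on (a,b), where either T(t) = −(n−1)/t or T ≡ 0. Assume [min_{closure(Ω)} u, max_{closure(Ω)} u] ⊆ [v(a), v(b)]. Then for every x ∈ closure(Ω): F(∇u(x)) ≤ v'( v⁻¹(u(x)) ), where v⁻¹ is the inverse of the strictly increasing function v on [a,b]. -/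

import Mathlib

open Real
open scoped RealInnerProductSpace

noncomputable section

/-- The `i`-th partial derivative of `f : ℝⁿ → ℝ` at `x`. -/
def pd {n : ℕ} (f : EuclideanSpace ℝ (Fin n) → ℝ) (i : Fin n)
    (x : EuclideanSpace ℝ (Fin n)) : ℝ :=
  fderiv ℝ f x (EuclideanSpace.single i 1)

/-- `a_{ij}(ξ) = ∂²(½F²)/∂ξ_i∂ξ_j (ξ)`. -/
def aCoeff {n : ℕ} (F : EuclideanSpace ℝ (Fin n) → ℝ) (i j : Fin n)
    (ξ : EuclideanSpace ℝ (Fin n)) : ℝ :=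
  pd (pd (fun η => F η ^ 2 / 2) i) j ξ

/-- A Minkowski norm on ℝⁿ: nonnegative, convex, even, positively 1-homogeneous,
and positive away from the origin. -/
structure IsMinkowskiNorm {n : ℕ} (F : EuclideanSpace ℝ (Fin n) → ℝ) : Prop where
  nonneg : ∀ ξ, 0 ≤ F ξ
  convexOn : ConvexOn ℝ Set.univ F
  even : ∀ ξ, F (-ξ) = F ξ
  homog : ∀ (t : ℝ) (ξ : EuclideanSpace ℝ (Fin n)), F (t • ξ) = |t| * F ξ
  pos : ∀ ξ, ξ ≠ 0 → 0 < F ξ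

/-- A strongly convex Minkowski norm of class C³: additionally `F` is C³ away from
the origin and the Hessian of `F²` is positive definite away from the origin. -/
structure IsStronglyConvexMinkowskiNormC3 {n : ℕ}
    (F : EuclideanSpace ℝ (Fin n) → ℝ) extends IsMinkowskiNorm F : Prop where
  contDiff3 : ContDiffOn ℝ 3 F {(0 : EuclideanSpace ℝ (Fin n))}ᶜ
  posDef : ∀ ξ : EuclideanSpace ℝ (Fin n), ξ ≠ 0 →
    ∀ V : EuclideanSpace ℝ (Fin n), V ≠ 0 →
      0 < ∑ i, ∑ j, aCoeff F i j ξ * V i * V j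

/-- A set has smooth boundary: near each boundary point there is a smooth local defining
function with nonvanishing differential. -/
def HasSmoothBoundary {n : ℕ} (Ω : Set (EuclideanSpace ℝ (Fin n))) : Prop :=
  ∀ x ∈ frontier Ω, ∃ U ∈ nhds x, ∃ f : EuclideanSpace ℝ (Fin n) → ℝ,
    ContDiff ℝ (⊤ : ℕ∞) f ∧ (∀ y ∈ U, (y ∈ Ω ↔ f y < 0)) ∧
      ∀ y ∈ U, y ∈ frontier Ω → fderiv ℝ f y ≠ 0

/-- `u` is a Neumann eigenfunction of the Finsler–Laplacian on `Ω` with eigenvalue `lam`: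
`u` is C¹ on the closure, C² where the gradient does not vanish, solves
`Σ a_{ij}(∇u) u_{ij} = −λ u` there, `F(∇u)F_ξ(∇u)` is continuous, and the anisotropic
Neumann condition `⟨F_ξ(∇u), ν⟩ = 0` holds at boundary points with `∇u ≠ 0`, for any
outward normal `ν` of the convex body `closure Ω`. -/
structure IsNeumannEigenfunction {n : ℕ} (F : EuclideanSpace ℝ (Fin n) → ℝ)
    (Ω : Set (EuclideanSpace ℝ (Fin n))) (lam : ℝ)
    (u : EuclideanSpace ℝ (Fin n) → ℝ) : Prop where
  contDiff1 : ContDiffOn ℝ 1 u (closure Ω)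
  contDiff2 : ContDiffOn ℝ 2 u {x ∈ closure Ω | gradient u x ≠ 0}
  eqn : ∀ x ∈ Ω, gradient u x ≠ 0 →
    ∑ i, ∑ j, aCoeff F i j (gradient u x) * pd (pd u i) j x = -lam * u x
  fluxCont : ContinuousOn
    (fun x => F (gradient u x) • gradient F (gradient u x)) (closure Ω)
  neumann : ∀ x ∈ frontier Ω, gradient u x ≠ 0 →
    ∀ ν : EuclideanSpace ℝ (Fin n), ν ≠ 0 →
      (∀ y ∈ closure Ω, ⟪ν, y - x⟫ ≤ 0) →
      ⟪gradient F (gradient u x), ν⟫ = 0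

section GradientComparison

open Set Filter Topology Asymptotics

/-- Second-order Taylor expansion within a convex set. -/
theorem taylor_two_isLittleO {X : Type*} [NormedAddCommGroup X] [InnerProductSpace ℝ X]
    [CompleteSpace X] {K : Set X} (hK : Convex ℝ K) {y : X} (hy : y ∈ K) {f : X → ℝ}
    {g : X → X} {H : X →L[ℝ] X}
    (hf : ∀ᶠ z in 𝓝[K] y, HasGradientWithinAt f (g z) K z)
    (hg : HasFDerivWithinAt g H K y) :
    (fun z => f z - f y - ⟪g y, z - y⟫ - ⟪H (z - y), z - y⟫ / 2)
      =o[𝓝[K] y] (fun z => ‖z - y‖ ^ 2) := by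
  rw [isLittleO_iff]
  intro C hC
  have h1 := hasFDerivWithinAt_iff_isLittleO.1 hg
  rw [isLittleO_iff] at h1
  have h2 := (h1 hC).and hf
  rw [Filter.eventually_iff, Metric.mem_nhdsWithin_iff] at h2
  obtain ⟨r, hr, hball⟩ := h2
  rw [Filter.eventually_iff, Metric.mem_nhdsWithin_iff]
  refine ⟨r, hr, ?_⟩
  rintro z ⟨hzr, hzK⟩
  have hseg : ∀ t ∈ Icc (0 : ℝ) 1, y + t • (z - y) ∈ Metric.ball y r ∩ K := by
    intro t ht
    have hc : Convex ℝ (Metric.ball y r ∩ K) := (convex_ball y r).inter hK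
    exact hc.add_smul_sub_mem ⟨Metric.mem_ball_self hr, hy⟩ ⟨hzr, hzK⟩ ht
  have hline : ∀ t : ℝ, HasDerivWithinAt (fun t : ℝ => y + t • (z - y)) (z - y) (Icc 0 1) t := by
    intro t
    have := ((hasDerivAt_id t).smul_const (z - y)).const_add y
    simpa using this.hasDerivWithinAt
  have hder : ∀ t ∈ Icc (0 : ℝ) 1, HasDerivWithinAt
      (fun t : ℝ => f (y + t • (z - y)) - t * ⟪g y, z - y⟫ - t ^ 2 * ⟪H (z - y), z - y⟫ / 2)
      (⟪g (y + t • (z - y)), z - y⟫ - ⟪g y, z - y⟫ - t * ⟪H (z - y), z - y⟫) (Icc 0 1) t := by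
    intro t ht
    have hh := (hball (hseg t ht)).2
    have h3 : HasDerivWithinAt (fun t : ℝ => f (y + t • (z - y)))
        ⟪g (y + t • (z - y)), z - y⟫ (Icc 0 1) t := by
      have := (hasGradientWithinAt_iff_hasFDerivWithinAt.1 hh).comp_hasDerivWithinAt t (hline t)
        (fun s hs => (hseg s hs).2)
      rw [InnerProductSpace.toDual_apply_apply] at this
      exact this
    have h4 : HasDerivWithinAt (fun t : ℝ => t * ⟪g y, z - y⟫) ⟪g y, z - y⟫ (Icc 0 1) t := by
      simpa using ((hasDerivAt_id t).mul_const ⟪g y, z - y⟫).hasDerivWithinAt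
    have h5 : HasDerivWithinAt (fun t : ℝ => t ^ 2 * ⟪H (z - y), z - y⟫ / 2)
        (t * ⟪H (z - y), z - y⟫) (Icc 0 1) t := by
      have := (((hasDerivAt_pow 2 t).mul_const ⟪H (z - y), z - y⟫).div_const 2).hasDerivWithinAt
        (s := Icc 0 1)
      refine this.congr_deriv ?_
      push_cast; ring
    exact (h3.sub h4).sub h5
  have hbd := norm_image_sub_le_of_norm_deriv_le_segment_01' (C := C * ‖z - y‖ ^ 2) hder (by
    intro t ht
    have ht' : t ∈ Icc (0 : ℝ) 1 := ⟨ht.1, ht.2.le⟩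
    have hh := (hball (hseg t ht')).1
    simp only [add_sub_cancel_left, map_smul] at hh
    have heq : ⟪g (y + t • (z - y)), z - y⟫ - ⟪g y, z - y⟫ - t * ⟪H (z - y), z - y⟫
        = ⟪g (y + t • (z - y)) - g y - t • H (z - y), z - y⟫ := by
      rw [inner_sub_left, inner_sub_left, real_inner_smul_left]
    rw [heq]
    calc ‖⟪g (y + t • (z - y)) - g y - t • H (z - y), z - y⟫‖
        ≤ ‖g (y + t • (z - y)) - g y - t • H (z - y)‖ * ‖z - y‖ := norm_inner_le_norm _ _
      _ ≤ (C * ‖t • (z - y)‖) * ‖z - y‖ := by gcongr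
      _ ≤ C * (1 * ‖z - y‖) * ‖z - y‖ := by
          rw [norm_smul]
          gcongr
          rw [Real.norm_eq_abs, abs_of_nonneg ht.1]
          exact ht.2.le
      _ = C * ‖z - y‖ ^ 2 := by ring)
  have e1 : f z - f y - ⟪g y, z - y⟫ - ⟪H (z - y), z - y⟫ / 2 =
      f (y + (1 : ℝ) • (z - y)) - 1 * ⟪g y, z - y⟫ - 1 ^ 2 * ⟪H (z - y), z - y⟫ / 2
      - (f (y + (0 : ℝ) • (z - y)) - 0 * ⟪g y, z - y⟫ - 0 ^ 2 * ⟪H (z - y), z - y⟫ / 2) := by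
    simp; ring
  simp only [mem_ofPred_eq]
  rw [e1]
  refine hbd.trans ?_
  simp

/-- `γ` is a curve leaving `y` with right velocity `p`. -/
def HasVelocity {X : Type*} [NormedAddCommGroup X] [NormedSpace ℝ X]
    (γ : ℝ → X) (y p : X) : Prop :=
  (fun τ => γ τ - y - τ • p) =o[𝓝[>] (0 : ℝ)] (fun τ : ℝ => τ)

section Velocity

variable {X : Type*} [NormedAddCommGroup X] [NormedSpace ℝ X]

theorem HasVelocity.line (y p : X) : HasVelocity (fun τ : ℝ => y + τ • p) y p := by
  simp [HasVelocity]

theorem HasVelocity.add {γ₁ γ₂ : ℝ → X} {y₁ y₂ p₁ p₂ : X} (h₁ : HasVelocity γ₁ y₁ p₁)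
    (h₂ : HasVelocity γ₂ y₂ p₂) : HasVelocity (fun τ => γ₁ τ + γ₂ τ) (y₁ + y₂) (p₁ + p₂) := by
  unfold HasVelocity at *
  refine (IsLittleO.add h₁ h₂).congr_left fun τ => ?_
  module

theorem HasVelocity.isBigO {γ : ℝ → X} {y p : X} (h : HasVelocity γ y p) :
    (fun τ => γ τ - y) =O[𝓝[>] (0 : ℝ)] (fun τ : ℝ => τ) := by
  have h2 : (fun τ : ℝ => τ • p) =O[𝓝[>] (0 : ℝ)] (fun τ : ℝ => τ) :=
    IsBigO.of_bound ‖p‖ (Eventually.of_forall fun τ => by rw [norm_smul, mul_comm])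
  refine ((IsLittleO.isBigO h).add h2).congr_left fun τ => by module

theorem tendsto_id_nhdsGT_zero : Tendsto (fun τ : ℝ => τ) (𝓝[>] 0) (𝓝 0) :=
  tendsto_id.mono_left nhdsWithin_le_nhds

theorem HasVelocity.tendsto {γ : ℝ → X} {y p : X} (h : HasVelocity γ y p) :
    Tendsto γ (𝓝[>] 0) (𝓝 y) := by
  have := h.isBigO.trans_tendsto tendsto_id_nhdsGT_zero
  simpa using this.add_const y

theorem HasVelocity.comp_hasFDerivWithinAt {Y : Type*} [NormedAddCommGroup Y] [NormedSpace ℝ Y]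
    {γ : ℝ → X} {y p : X} (h : HasVelocity γ y p) {K : Set X}
    (hK : ∀ᶠ τ in 𝓝[>] (0 : ℝ), γ τ ∈ K) {G : X → Y} {G' : X →L[ℝ] Y}
    (hG : HasFDerivWithinAt G G' K y) : HasVelocity (fun τ => G (γ τ)) (G y) (G' p) := by
  have h1 := (hasFDerivWithinAt_iff_isLittleO.1 hG).comp_tendsto
    (tendsto_nhdsWithin_iff.2 ⟨h.tendsto, hK⟩)
  have h2 := h1.trans_isBigO h.isBigO
  have h3 := (G'.isBigO_comp (fun τ => γ τ - y - τ • p) (𝓝[>] (0 : ℝ))).trans_isLittleO h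
  refine (h2.add h3).congr_left fun τ => ?_
  simp only [Function.comp, map_sub, map_smul]
  module

theorem HasVelocity.smul {γ : ℝ → X} {y p : X} (h : HasVelocity γ y p) {r : ℝ → ℝ} {d r₁ : ℝ}
    (hr : HasVelocity r d r₁) : HasVelocity (fun τ => r τ • γ τ) (d • y) (r₁ • y + d • p) := by
  have hone : Tendsto r (𝓝[>] 0) (𝓝 d) := hr.tendsto
  have h1 : (fun τ => r τ • (γ τ - y - τ • p)) =o[𝓝[>] (0 : ℝ)] (fun τ : ℝ => τ) := by
    have := (hone.isBigO_one ℝ).smul_isLittleO h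
    simpa using this
  have h2 : (fun τ => (r τ - d - τ • r₁) • y) =o[𝓝[>] (0 : ℝ)] (fun τ : ℝ => τ) := by
    have := hr.smul_isBigO (isBigO_refl (fun _ : ℝ => y) (𝓝[>] (0 : ℝ)))
    have h3 : (fun τ : ℝ => τ • y) =O[𝓝[>] (0 : ℝ)] (fun τ : ℝ => τ) :=
      IsBigO.of_bound ‖y‖ (Eventually.of_forall fun τ => by rw [norm_smul, mul_comm])
    exact this.trans_isBigO h3
  have h4 : (fun τ => (r τ - d) • (τ • p)) =o[𝓝[>] (0 : ℝ)] (fun τ : ℝ => τ) := by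
    have h5 : (fun τ => r τ - d) =o[𝓝[>] (0 : ℝ)] (fun _ => (1 : ℝ)) := by
      rw [isLittleO_one_iff]
      simpa using hone.sub_const d
    have h6 : (fun τ : ℝ => τ • p) =O[𝓝[>] (0 : ℝ)] (fun τ : ℝ => τ) :=
      IsBigO.of_bound ‖p‖ (Eventually.of_forall fun τ => by rw [norm_smul, mul_comm])
    simpa using h5.smul_isBigO h6
  refine ((h1.add h2).add h4).congr_left fun τ => ?_
  simp only [smul_sub, sub_smul, smul_add, smul_eq_mul, mul_smul]
  rw [smul_comm d τ p]
  module

end Velocity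

/-- Second-order expansion along a curve with a velocity. -/
theorem taylor_two_curve {X : Type*} [NormedAddCommGroup X] [InnerProductSpace ℝ X]
    [CompleteSpace X] {K : Set X} (hK : Convex ℝ K) {y : X} (hy : y ∈ K) {f : X → ℝ}
    {g : X → X} {H : X →L[ℝ] X}
    (hf : ∀ᶠ z in 𝓝[K] y, HasGradientWithinAt f (g z) K z)
    (hg : HasFDerivWithinAt g H K y) {γ : ℝ → X} {p : X} (hγ : HasVelocity γ y p)
    (hγK : ∀ᶠ τ in 𝓝[>] (0 : ℝ), γ τ ∈ K) :
    (fun τ => f (γ τ) - f y - ⟪g y, γ τ - y⟫ - ⟪H p, p⟫ / 2 * τ ^ 2)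
      =o[𝓝[>] (0 : ℝ)] (fun τ : ℝ => τ ^ 2) := by
  have h1 := (taylor_two_isLittleO hK hy hf hg).comp_tendsto
    (tendsto_nhdsWithin_iff.2 ⟨hγ.tendsto, hγK⟩)
  have h2 : (fun τ => ‖γ τ - y‖ ^ 2) =O[𝓝[>] (0 : ℝ)] (fun τ : ℝ => τ ^ 2) :=
    hγ.isBigO.norm_left.pow 2
  have h3 := h1.trans_isBigO h2
  have h4 : (fun τ => ⟪H (γ τ - y - τ • p), γ τ - y⟫ + ⟪H (τ • p), γ τ - y - τ • p⟫)
      =o[𝓝[>] (0 : ℝ)] (fun τ : ℝ => τ ^ 2) := by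
    have a1 := (H.isBigO_comp (fun τ => γ τ - y - τ • p) (𝓝[>] (0 : ℝ))).trans_isLittleO hγ
    have a2 : (fun τ : ℝ => H (τ • p)) =O[𝓝[>] (0 : ℝ)] (fun τ : ℝ => τ) :=
      IsBigO.of_bound ‖H p‖ (Eventually.of_forall fun τ => by
        rw [map_smul, norm_smul, mul_comm])
    have b1 : (fun τ => ⟪H (γ τ - y - τ • p), γ τ - y⟫) =o[𝓝[>] (0 : ℝ)]
        (fun τ : ℝ => τ * τ) := by
      refine IsLittleO.of_norm_left ?_
      refine IsBigO.trans_isLittleO ?_ (a1.norm_left.mul_isBigO hγ.isBigO.norm_left)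
      exact IsBigO.of_bound 1 (Eventually.of_forall fun τ => by
        simpa using abs_real_inner_le_norm _ _)
    have b2 : (fun τ => ⟪H (τ • p), γ τ - y - τ • p⟫) =o[𝓝[>] (0 : ℝ)]
        (fun τ : ℝ => τ * τ) := by
      refine IsLittleO.of_norm_left ?_
      refine IsBigO.trans_isLittleO ?_ (a2.norm_left.mul_isLittleO hγ.norm_left)
      exact IsBigO.of_bound 1 (Eventually.of_forall fun τ => by
        simpa using abs_real_inner_le_norm _ _)
    simpa [pow_two] using b1.add b2
  refine (h3.add (h4.const_mul_left (1 / 2))).congr_left fun τ => ?_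
  simp only [Function.comp, map_sub, map_smul, inner_sub_left, inner_sub_right,
    real_inner_smul_left, real_inner_smul_right]
  ring

theorem nonpos_of_isLittleO_sq {e : ℝ → ℝ} {A : ℝ}
    (he : (fun τ => e τ - A * τ ^ 2) =o[𝓝[>] (0 : ℝ)] (fun τ : ℝ => τ ^ 2))
    (hle : ∀ᶠ τ in 𝓝[>] (0 : ℝ), e τ ≤ 0) : A ≤ 0 := by
  by_contra! hA
  have h1 := (isLittleO_iff.1 he) (half_pos hA)
  have h2 : ∀ᶠ τ in 𝓝[>] (0 : ℝ), 0 < τ := eventually_mem_nhdsWithin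
  obtain ⟨τ, ⟨h3, h4⟩, h5⟩ := ((h1.and hle).and h2).exists
  rw [Real.norm_eq_abs, Real.norm_eq_abs, abs_of_pos (by positivity : 0 < τ ^ 2)] at h3
  have := (abs_le.1 h3).1
  nlinarith [pow_pos h5 2]

theorem nonpos_of_isLittleO_id {e : ℝ → ℝ} {A : ℝ}
    (he : (fun τ => e τ - A * τ) =o[𝓝[>] (0 : ℝ)] (fun τ : ℝ => τ))
    (hle : ∀ᶠ τ in 𝓝[>] (0 : ℝ), e τ ≤ 0) : A ≤ 0 := by
  by_contra! hA
  have h1 := (isLittleO_iff.1 he) (half_pos hA)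
  have h2 : ∀ᶠ τ in 𝓝[>] (0 : ℝ), 0 < τ := eventually_mem_nhdsWithin
  obtain ⟨τ, ⟨h3, h4⟩, h5⟩ := ((h1.and hle).and h2).exists
  rw [Real.norm_eq_abs, Real.norm_eq_abs, abs_of_pos h5] at h3
  have := (abs_le.1 h3).1
  nlinarith

section Hessian

variable {n : ℕ}

theorem inner_fderiv_gradient (f : EuclideanSpace ℝ (Fin n) → ℝ)
    (x v w : EuclideanSpace ℝ (Fin n)) :
    ⟪fderiv ℝ (gradient f) x v, w⟫ = fderiv ℝ (fderiv ℝ f) x v w := by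
  have h : gradient f = (InnerProductSpace.toDual ℝ (EuclideanSpace ℝ (Fin n))).symm ∘
      fderiv ℝ f := rfl
  rw [h, LinearIsometryEquiv.comp_fderiv]
  exact InnerProductSpace.toDual_symm_apply

theorem pd_eq_inner (f : EuclideanSpace ℝ (Fin n) → ℝ) (i : Fin n)
    (x : EuclideanSpace ℝ (Fin n)) :
    pd f i x = ⟪gradient f x, EuclideanSpace.single i 1⟫ := by
  rw [inner_gradient_left]; rfl

theorem pd_pd_eq_inner {f : EuclideanSpace ℝ (Fin n) → ℝ} {x : EuclideanSpace ℝ (Fin n)}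
    (hf : DifferentiableAt ℝ (gradient f) x) (i j : Fin n) :
    pd (pd f i) j x =
      ⟪fderiv ℝ (gradient f) x (EuclideanSpace.single j 1), EuclideanSpace.single i 1⟫ := by
  have h : pd f i = fun y => ⟪gradient f y, EuclideanSpace.single i 1⟫ :=
    funext fun y => pd_eq_inner f i y
  rw [pd, h, fderiv_inner_apply ℝ hf (differentiableAt_const _)]
  simp

theorem ContDiffAt.gradient {f : EuclideanSpace ℝ (Fin n) → ℝ} {x : EuclideanSpace ℝ (Fin n)}
    {k m : WithTop ℕ∞} (hf : ContDiffAt ℝ m f x) (hkm : k + 1 ≤ m) :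
    ContDiffAt ℝ k (gradient f) x :=
  (InnerProductSpace.toDual ℝ (EuclideanSpace ℝ (Fin n))).symm.toContinuousLinearEquiv.contDiff.contDiffAt.comp x
    (hf.fderiv_right hkm)

/-- The sum of products of matrix entries of two operators, one of them symmetric, computed in an
eigenbasis. -/
theorem sum_inner_mul_inner_eq {A M : EuclideanSpace ℝ (Fin n) →L[ℝ] EuclideanSpace ℝ (Fin n)}
    (hA : ∀ v w, ⟪A v, w⟫ = ⟪v, A w⟫)
    (f : OrthonormalBasis (Fin n) ℝ (EuclideanSpace ℝ (Fin n))) (μ : Fin n → ℝ)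
    (hf : ∀ k, A (f k) = μ k • f k) :
    ∑ i, ∑ j, ⟪A (EuclideanSpace.single j 1), EuclideanSpace.single i 1⟫ *
      ⟪M (EuclideanSpace.single j 1), EuclideanSpace.single i 1⟫ =
      ∑ k, μ k * ⟪M (f k), f k⟫ := by
  have key : ∀ b : OrthonormalBasis (Fin n) ℝ (EuclideanSpace ℝ (Fin n)),
      ∑ j, ⟪M (b j), A (b j)⟫ = LinearMap.trace ℝ _ (A ∘L M).toLinearMap := by
    intro b
    rw [LinearMap.trace_eq_sum_inner _ b]
    refine Finset.sum_congr rfl fun j _ => ?_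
    rw [real_inner_comm, hA]
    rfl
  have h1 := key (EuclideanSpace.basisFun (Fin n) ℝ)
  have h2 := key f
  rw [Finset.sum_comm]
  have h3 : ∀ j, ∑ i, ⟪A (EuclideanSpace.single j 1), EuclideanSpace.single i 1⟫ *
      ⟪M (EuclideanSpace.single j 1), EuclideanSpace.single i 1⟫ =
      ⟪M (EuclideanSpace.single j 1), A (EuclideanSpace.single j 1)⟫ := by
    intro j
    rw [← (EuclideanSpace.basisFun (Fin n) ℝ).sum_inner_mul_inner]
    refine Finset.sum_congr rfl fun i _ => ?_
    rw [EuclideanSpace.basisFun_apply, mul_comm,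
      real_inner_comm (A (EuclideanSpace.single j 1)) (EuclideanSpace.single i 1)]
  rw [Finset.sum_congr rfl fun j _ => h3 j]
  simp only [EuclideanSpace.basisFun_apply] at h1
  rw [h1, ← h2]
  refine Finset.sum_congr rfl fun k _ => ?_
  rw [hf, real_inner_smul_right]

end Hessian

namespace IsStronglyConvexMinkowskiNormC3

variable {n : ℕ} {F : EuclideanSpace ℝ (Fin n) → ℝ}

theorem map_zero (hF : IsStronglyConvexMinkowskiNormC3 F) : F 0 = 0 := by
  simpa using hF.homog 0 0

theorem contDiffAt (hF : IsStronglyConvexMinkowskiNormC3 F) {ξ : EuclideanSpace ℝ (Fin n)}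
    (hξ : ξ ≠ 0) : ContDiffAt ℝ 3 F ξ :=
  hF.contDiff3.contDiffAt (isOpen_compl_singleton.mem_nhds hξ)

theorem hasGradientAt (hF : IsStronglyConvexMinkowskiNormC3 F) {ξ : EuclideanSpace ℝ (Fin n)}
    (hξ : ξ ≠ 0) : HasGradientAt F (gradient F ξ) ξ :=
  ((hF.contDiffAt hξ).differentiableAt (by norm_num)).hasGradientAt

theorem contDiffAt_gradient (hF : IsStronglyConvexMinkowskiNormC3 F)
    {ξ : EuclideanSpace ℝ (Fin n)} (hξ : ξ ≠ 0) : ContDiffAt ℝ 2 (gradient F) ξ :=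
  (hF.contDiffAt hξ).gradient (by norm_num)

theorem hasFDerivAt_gradient (hF : IsStronglyConvexMinkowskiNormC3 F)
    {ξ : EuclideanSpace ℝ (Fin n)} (hξ : ξ ≠ 0) :
    HasFDerivAt (gradient F) (fderiv ℝ (gradient F) ξ) ξ :=
  ((hF.contDiffAt_gradient hξ).differentiableAt (by norm_num)).hasFDerivAt

theorem hasDerivAt_line (hF : IsStronglyConvexMinkowskiNormC3 F) {ξ : EuclideanSpace ℝ (Fin n)}
    (hξ : ξ ≠ 0) (b : EuclideanSpace ℝ (Fin n)) :
    HasDerivAt (fun t : ℝ => F (ξ + t • b)) ⟪gradient F ξ, b⟫ 0 := by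
  have h1 : HasDerivAt (fun t : ℝ => ξ + t • b) b 0 := by
    simpa using ((hasDerivAt_id (0 : ℝ)).smul_const b).const_add ξ
  have h2 : HasFDerivAt F ((InnerProductSpace.toDual ℝ _) (gradient F ξ)) (ξ + (0 : ℝ) • b) := by
    simpa using (hF.hasGradientAt hξ).hasFDerivAt
  exact h2.comp_hasDerivAt 0 h1

/-- Euler's identity. -/
theorem inner_gradient_self (hF : IsStronglyConvexMinkowskiNormC3 F)
    {ξ : EuclideanSpace ℝ (Fin n)} (hξ : ξ ≠ 0) : ⟪gradient F ξ, ξ⟫ = F ξ := by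
  have h1 := hF.hasDerivAt_line hξ ξ
  have h2 : HasDerivAt (fun t : ℝ => (1 + t) * F ξ) (F ξ) 0 := by
    simpa using ((hasDerivAt_id (0 : ℝ)).const_add 1).mul_const (F ξ)
  refine h1.unique (h2.congr_of_eventuallyEq ?_)
  filter_upwards [Ioi_mem_nhds (show (-1 : ℝ) < 0 by norm_num)] with t ht
  have : ξ + t • ξ = (1 + t) • ξ := by module
  rw [this, hF.homog, abs_of_pos (by linarith [mem_Ioi.1 ht])]

theorem inner_gradient_le (hF : IsStronglyConvexMinkowskiNormC3 F)
    {ξ : EuclideanSpace ℝ (Fin n)} (hξ : ξ ≠ 0) (ζ : EuclideanSpace ℝ (Fin n)) :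
    ⟪gradient F ξ, ζ⟫ ≤ F ζ := by
  have h1 := hF.hasDerivAt_line hξ (ζ - ξ)
  have h2 := hF.inner_gradient_self hξ
  have h3 : ⟪gradient F ξ, ζ - ξ⟫ ≤ F ζ - F ξ := by
    have h4 := h1.tendsto_slope_zero_right
    refine le_of_tendsto h4 ?_
    have hev : ∀ᶠ t in 𝓝[>] (0 : ℝ), t ∈ Ioo (0 : ℝ) 1 := Ioo_mem_nhdsGT (by norm_num)
    filter_upwards [hev] with t ht
    have h5 := hF.convexOn.2 (mem_univ ξ) (mem_univ ζ) (sub_nonneg.2 ht.2.le) ht.1.le (by ring)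
    have h6 : (1 - t) • ξ + t • ζ = ξ + t • (ζ - ξ) := by module
    rw [h6] at h5
    simp only [zero_add, zero_smul, add_zero, smul_eq_mul] at h5 ⊢
    rw [inv_mul_le_iff₀ ht.1]
    linarith
  rw [inner_sub_right] at h3
  linarith

theorem gradient_smul (hF : IsStronglyConvexMinkowskiNormC3 F) {ξ : EuclideanSpace ℝ (Fin n)}
    (hξ : ξ ≠ 0) {t : ℝ} (ht : 0 < t) : gradient F (t • ξ) = gradient F ξ := by
  have hne : t • ξ ≠ 0 := smul_ne_zero ht.ne' hξ
  refine ext_inner_right ℝ fun v => ?_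
  have h1 := (hF.hasGradientAt hne).hasFDerivAt
  have h2 : HasFDerivAt (fun η : EuclideanSpace ℝ (Fin n) => t • η) (t • ContinuousLinearMap.id ℝ _) ξ :=
    (hasFDerivAt_id ξ).const_smul t
  have h3 := h1.comp ξ h2
  have h4 : HasFDerivAt (fun η => t * F η) (t • (InnerProductSpace.toDual ℝ _) (gradient F ξ)) ξ :=
    (hF.hasGradientAt hξ).hasFDerivAt.const_mul t
  have h5 : (F ∘ fun η : EuclideanSpace ℝ (Fin n) => t • η) = fun η => t * F η := by
    funext η
    simp [hF.homog, abs_of_pos ht]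
  rw [h5] at h3
  have h6 := congrArg (fun L => L v) (h3.unique h4)
  simp only [ContinuousLinearMap.comp_apply, _root_.smul_apply,
    ContinuousLinearMap.id_apply, InnerProductSpace.toDual_apply_apply, real_inner_smul_right,
    smul_eq_mul] at h6
  exact mul_left_cancel₀ ht.ne' h6

theorem gradient_neg (hF : IsStronglyConvexMinkowskiNormC3 F) {ξ : EuclideanSpace ℝ (Fin n)}
    (hξ : ξ ≠ 0) : gradient F (-ξ) = -gradient F ξ := by
  have hne : -ξ ≠ 0 := neg_ne_zero.2 hξ
  refine ext_inner_right ℝ fun v => ?_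
  have h1 := (hF.hasGradientAt hne).hasFDerivAt
  have h3 := h1.comp ξ (hasFDerivAt_id ξ).neg
  have h5 : (F ∘ fun η : EuclideanSpace ℝ (Fin n) => - id η) = F := by
    funext η
    simp [hF.even]
  have h3' : HasFDerivAt (F ∘ fun η : EuclideanSpace ℝ (Fin n) => - id η) _ ξ := h3
  rw [h5] at h3'
  have h6 := congrArg (fun L => L v) (h3'.unique (hF.hasGradientAt hξ).hasFDerivAt)
  simp at h6
  rw [inner_neg_left, inner_gradient_left, inner_gradient_left]
  linarith

theorem inner_hessian_comm (hF : IsStronglyConvexMinkowskiNormC3 F)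
    {ξ : EuclideanSpace ℝ (Fin n)} (hξ : ξ ≠ 0) (v w : EuclideanSpace ℝ (Fin n)) :
    ⟪fderiv ℝ (gradient F) ξ v, w⟫ = ⟪v, fderiv ℝ (gradient F) ξ w⟫ := by
  rw [real_inner_comm _ v, inner_fderiv_gradient, inner_fderiv_gradient]
  exact (((hF.contDiffAt hξ).isSymmSndFDerivAt (by simp; norm_num)).eq v w)

theorem hessian_self (hF : IsStronglyConvexMinkowskiNormC3 F)
    {ξ : EuclideanSpace ℝ (Fin n)} (hξ : ξ ≠ 0) : fderiv ℝ (gradient F) ξ ξ = 0 := by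
  have h1 : HasDerivAt (fun t : ℝ => ξ + t • ξ) ξ 0 := by
    simpa using ((hasDerivAt_id (0 : ℝ)).smul_const ξ).const_add ξ
  have h2 : HasFDerivAt (gradient F) (fderiv ℝ (gradient F) ξ) (ξ + (0 : ℝ) • ξ) := by
    simpa using hF.hasFDerivAt_gradient hξ
  have h3 := h2.comp_hasDerivAt 0 h1
  refine h3.unique ((hasDerivAt_const (0 : ℝ) (gradient F ξ)).congr_of_eventuallyEq ?_)
  filter_upwards [Ioi_mem_nhds (show (-1 : ℝ) < 0 by norm_num)] with t ht
  have : ξ + t • ξ = (1 + t) • ξ := by module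
  simp only [Function.comp, this]
  rw [hF.gradient_smul hξ (by linarith [mem_Ioi.1 ht])]

theorem aCoeff_eq (hF : IsStronglyConvexMinkowskiNormC3 F)
    {ξ : EuclideanSpace ℝ (Fin n)} (hξ : ξ ≠ 0) (i j : Fin n) :
    aCoeff F i j ξ = ⟪gradient F ξ, EuclideanSpace.single i 1⟫ *
      ⟪gradient F ξ, EuclideanSpace.single j 1⟫ + F ξ *
      ⟪fderiv ℝ (gradient F) ξ (EuclideanSpace.single j 1), EuclideanSpace.single i 1⟫ := by
  have h1 : pd (fun η => F η ^ 2 / 2) i =ᶠ[𝓝 ξ]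
      fun η => F η * ⟪gradient F η, EuclideanSpace.single i 1⟫ := by
    filter_upwards [isOpen_compl_singleton.mem_nhds hξ] with η hη
    have h2 := ((hF.hasGradientAt hη).hasFDerivAt.pow 2).mul_const (2⁻¹ : ℝ)
    simp only [← div_eq_mul_inv] at h2
    rw [pd, h2.fderiv]
    simp
    ring
  have h3 : HasFDerivAt (fun η => ⟪gradient F η, EuclideanSpace.single i (1 : ℝ)⟫) _ ξ :=
    (hF.hasFDerivAt_gradient hξ).inner ℝ (hasFDerivAt_const _ _)
  have h4 : HasFDerivAt (fun η => F η * ⟪gradient F η, EuclideanSpace.single i (1 : ℝ)⟫) _ ξ :=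
    (hF.hasGradientAt hξ).hasFDerivAt.mul h3
  rw [aCoeff, pd, h1.fderiv_eq, h4.fderiv]
  simp
  ring

theorem sum_aCoeff_quadratic (hF : IsStronglyConvexMinkowskiNormC3 F)
    {ξ : EuclideanSpace ℝ (Fin n)} (hξ : ξ ≠ 0) (V : EuclideanSpace ℝ (Fin n)) :
    ∑ i, ∑ j, aCoeff F i j ξ * V i * V j =
      ⟪gradient F ξ, V⟫ ^ 2 + F ξ * ⟪fderiv ℝ (gradient F) ξ V, V⟫ := by
  have hV : V = ∑ i, V i • EuclideanSpace.single i (1 : ℝ) := by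
    simpa using ((EuclideanSpace.basisFun (Fin n) ℝ).sum_repr V).symm
  have e1 : ⟪gradient F ξ, V⟫ = ∑ i, V i * ⟪gradient F ξ, EuclideanSpace.single i (1 : ℝ)⟫ := by
    conv_lhs => rw [hV]
    rw [inner_sum]
    simp only [real_inner_smul_right]
  have e2 : ⟪fderiv ℝ (gradient F) ξ V, V⟫ = ∑ i, ∑ j, V i * (V j *
      ⟪fderiv ℝ (gradient F) ξ (EuclideanSpace.single j 1), EuclideanSpace.single i 1⟫) := by
    conv_lhs => rw [hV]
    rw [inner_sum, map_sum]
    refine Finset.sum_congr rfl fun i _ => ?_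
    rw [real_inner_smul_right, sum_inner, Finset.mul_sum]
    simp only [map_smul, real_inner_smul_left]
  rw [e1, e2, pow_two, Finset.sum_mul_sum, Finset.mul_sum, ← Finset.sum_add_distrib]
  refine Finset.sum_congr rfl fun i _ => ?_
  rw [Finset.mul_sum, ← Finset.sum_add_distrib]
  refine Finset.sum_congr rfl fun j _ => ?_
  rw [hF.aCoeff_eq hξ]
  ring

theorem quadratic_pos (hF : IsStronglyConvexMinkowskiNormC3 F)
    {ξ : EuclideanSpace ℝ (Fin n)} (hξ : ξ ≠ 0) {V : EuclideanSpace ℝ (Fin n)} (hV : V ≠ 0) :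
    0 < ⟪gradient F ξ, V⟫ ^ 2 + F ξ * ⟪fderiv ℝ (gradient F) ξ V, V⟫ := by
  rw [← hF.sum_aCoeff_quadratic hξ]
  exact hF.posDef ξ hξ V hV

theorem sum_aCoeff_inner (hF : IsStronglyConvexMinkowskiNormC3 F)
    {ξ : EuclideanSpace ℝ (Fin n)} (hξ : ξ ≠ 0)
    (M : EuclideanSpace ℝ (Fin n) →L[ℝ] EuclideanSpace ℝ (Fin n))
    (f : OrthonormalBasis (Fin n) ℝ (EuclideanSpace ℝ (Fin n))) (μ : Fin n → ℝ)
    (hf : ∀ k, fderiv ℝ (gradient F) ξ (f k) = μ k • f k) :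
    ∑ i, ∑ j, aCoeff F i j ξ * ⟪M (EuclideanSpace.single j 1), EuclideanSpace.single i 1⟫ =
      ⟪M (gradient F ξ), gradient F ξ⟫ + F ξ * ∑ k, μ k * ⟪M (f k), f k⟫ := by
  set e := gradient F ξ with he
  have hV : e = ∑ i, ⟪e, EuclideanSpace.single i (1 : ℝ)⟫ • EuclideanSpace.single i (1 : ℝ) := by
    have := ((EuclideanSpace.basisFun (Fin n) ℝ).sum_repr' e).symm
    simp only [EuclideanSpace.basisFun_apply] at this
    exact this.trans (Finset.sum_congr rfl fun i _ => by rw [real_inner_comm])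
  have e1 : ⟪M e, e⟫ = ∑ i, ∑ j, ⟪e, EuclideanSpace.single i (1 : ℝ)⟫ *
      (⟪e, EuclideanSpace.single j (1 : ℝ)⟫ *
      ⟪M (EuclideanSpace.single j 1), EuclideanSpace.single i 1⟫) := by
    conv_lhs => rw [hV]
    rw [inner_sum, map_sum]
    refine Finset.sum_congr rfl fun i _ => ?_
    rw [real_inner_smul_right, sum_inner, Finset.mul_sum]
    simp only [map_smul, real_inner_smul_left]
  rw [← sum_inner_mul_inner_eq (hF.inner_hessian_comm hξ) f μ hf, e1, Finset.mul_sum,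
    ← Finset.sum_add_distrib]
  refine Finset.sum_congr rfl fun i _ => ?_
  rw [Finset.mul_sum, ← Finset.sum_add_distrib]
  refine Finset.sum_congr rfl fun j _ => ?_
  rw [hF.aCoeff_eq hξ]
  ring

theorem hasVelocity_gradient (hF : IsStronglyConvexMinkowskiNormC3 F)
    {ξ : EuclideanSpace ℝ (Fin n)} (hξ : ξ ≠ 0) (b : EuclideanSpace ℝ (Fin n)) :
    HasVelocity (fun τ => gradient F (ξ + τ • b)) (gradient F ξ)
      (fderiv ℝ (gradient F) ξ b) :=
  (HasVelocity.line ξ b).comp_hasFDerivWithinAt (K := univ) (by simp)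
    (hF.hasFDerivAt_gradient hξ).hasFDerivWithinAt

theorem eventually_line_ne_zero {ξ : EuclideanSpace ℝ (Fin n)} (hξ : ξ ≠ 0)
    (b : EuclideanSpace ℝ (Fin n)) : ∀ᶠ τ in 𝓝[>] (0 : ℝ), ξ + τ • b ≠ 0 :=
  (HasVelocity.line ξ b).tendsto.eventually_ne hξ

theorem taylor_two (hF : IsStronglyConvexMinkowskiNormC3 F)
    {ξ : EuclideanSpace ℝ (Fin n)} (hξ : ξ ≠ 0) (b : EuclideanSpace ℝ (Fin n)) :
    (fun τ : ℝ => F (ξ + τ • b) - F ξ - τ * ⟪gradient F ξ, b⟫ -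
      ⟪fderiv ℝ (gradient F) ξ b, b⟫ / 2 * τ ^ 2) =o[𝓝[>] (0 : ℝ)] (fun τ : ℝ => τ ^ 2) := by
  have h := taylor_two_curve (K := univ) convex_univ (mem_univ ξ) (f := F) (g := gradient F)
    (H := fderiv ℝ (gradient F) ξ) (by
      rw [nhdsWithin_univ]
      filter_upwards [isOpen_compl_singleton.mem_nhds hξ] with η hη
      exact (hasGradientWithinAt_univ).2 (hF.hasGradientAt hη))
    (hF.hasFDerivAt_gradient hξ).hasFDerivWithinAt (HasVelocity.line ξ b) (by simp)
  refine h.congr_left fun τ => ?_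
  simp

theorem hessian_nonneg (hF : IsStronglyConvexMinkowskiNormC3 F)
    {ξ : EuclideanSpace ℝ (Fin n)} (hξ : ξ ≠ 0) (b : EuclideanSpace ℝ (Fin n)) :
    0 ≤ ⟪fderiv ℝ (gradient F) ξ b, b⟫ := by
  have h := nonpos_of_isLittleO_sq (e := fun τ => -(F (ξ + τ • b) - F ξ - τ * ⟪gradient F ξ, b⟫))
    (A := -(⟪fderiv ℝ (gradient F) ξ b, b⟫ / 2))
    ((hF.taylor_two hξ b).neg_left.congr_left fun τ => by ring)
    (Eventually.of_forall fun τ => by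
      have h1 := hF.inner_gradient_le hξ (ξ + τ • b)
      rw [inner_add_right, hF.inner_gradient_self hξ, real_inner_smul_right] at h1
      linarith)
  linarith

/-- The pairing of `ξ` with `∇F(ξ + τ b)` to second order. -/
theorem inner_gradient_line (hF : IsStronglyConvexMinkowskiNormC3 F)
    {ξ : EuclideanSpace ℝ (Fin n)} (hξ : ξ ≠ 0) (b : EuclideanSpace ℝ (Fin n)) :
    (fun τ : ℝ => ⟪ξ, gradient F (ξ + τ • b)⟫ - F ξ +
      ⟪fderiv ℝ (gradient F) ξ b, b⟫ / 2 * τ ^ 2) =o[𝓝[>] (0 : ℝ)] (fun τ : ℝ => τ ^ 2) := by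
  have h1 := hF.taylor_two hξ b
  have h2 := hF.hasVelocity_gradient hξ b
  have h3 : (fun τ : ℝ => τ * ⟪b, gradient F (ξ + τ • b) - gradient F ξ -
      τ • fderiv ℝ (gradient F) ξ b⟫) =o[𝓝[>] (0 : ℝ)] (fun τ : ℝ => τ * τ) := by
    refine (isBigO_refl _ _).mul_isLittleO ?_
    exact (((innerSL ℝ b).isBigO_comp _ _).trans_isLittleO h2)
  have h4 := h1.sub (h3.congr_right fun τ => (pow_two τ).symm)
  refine h4.congr' ?_ (EventuallyEq.refl _ _)
  filter_upwards [eventually_line_ne_zero hξ b] with τ hτ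
  have h5 := hF.inner_gradient_self hτ
  rw [inner_add_right, real_inner_smul_right, real_inner_comm, real_inner_comm b] at h5
  rw [← h5]
  simp only [inner_sub_right, real_inner_smul_right]
  rw [real_inner_comm b (gradient F ξ), real_inner_comm b (fderiv ℝ (gradient F) ξ b)]
  ring

/-- Solvability of the linearised parametrisation `r ∇F(ξ)` of the ambient space. -/
theorem exists_decomposition (hF : IsStronglyConvexMinkowskiNormC3 F)
    {ξ : EuclideanSpace ℝ (Fin n)} (hξ : ξ ≠ 0) (p : EuclideanSpace ℝ (Fin n)) :
    ∃ b, p = (⟪ξ, p⟫ / F ξ) • gradient F ξ + fderiv ℝ (gradient F) ξ b := by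
  set A : EuclideanSpace ℝ (Fin n) →ₗ[ℝ] EuclideanSpace ℝ (Fin n) :=
    ((innerSL ℝ (gradient F ξ)).smulRight (gradient F ξ) +
      F ξ • fderiv ℝ (gradient F) ξ).toLinearMap with hA
  have hAv : ∀ v, A v = ⟪gradient F ξ, v⟫ • gradient F ξ + F ξ • fderiv ℝ (gradient F) ξ v := by
    intro v
    simp [hA]
  have hinj : Function.Injective A := by
    rw [← LinearMap.ker_eq_bot, LinearMap.ker_eq_bot']
    intro v hv
    by_contra hne
    have h1 := hF.quadratic_pos hξ hne
    have h2 : ⟪A v, v⟫ = 0 := by rw [hv, inner_zero_left]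
    rw [hAv, inner_add_left, real_inner_smul_left, real_inner_smul_left] at h2
    nlinarith
  obtain ⟨b, hb⟩ := LinearMap.injective_iff_surjective.1 hinj p
  have hpos := hF.pos ξ hξ
  have h3 : ⟪ξ, p⟫ = F ξ * ⟪gradient F ξ, b⟫ := by
    rw [← hb, hAv, inner_add_right, real_inner_smul_right, real_inner_smul_right,
      ← hF.inner_hessian_comm hξ, hF.hessian_self hξ, inner_zero_left,
      real_inner_comm (gradient F ξ) ξ, hF.inner_gradient_self hξ]
    ring
  refine ⟨F ξ • b, ?_⟩
  rw [h3, map_smul, mul_div_cancel_left₀ _ hpos.ne', ← hAv, hb]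

/-- Equality case of the support inequality. -/
theorem eq_of_inner_gradient_eq (hF : IsStronglyConvexMinkowskiNormC3 F)
    {ξ η : EuclideanSpace ℝ (Fin n)} (hη : η ≠ 0) (h1 : ⟪gradient F η, ξ⟫ = F η)
    (h2 : F ξ = F η) : ξ = η := by
  by_contra hne
  have hζ : ξ - η ≠ 0 := sub_ne_zero.2 hne
  have h3 := hF.quadratic_pos hη hζ
  have h4 : ⟪gradient F η, ξ - η⟫ = 0 := by
    rw [inner_sub_right, h1, hF.inner_gradient_self hη, sub_self]
  have h5 := nonpos_of_isLittleO_sq (e := fun τ : ℝ => F (η + τ • (ξ - η)) - F η)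
    (A := ⟪fderiv ℝ (gradient F) η (ξ - η), ξ - η⟫ / 2)
    ((hF.taylor_two hη (ξ - η)).congr_left fun τ => by rw [h4]; ring) (by
      have hev : ∀ᶠ t in 𝓝[>] (0 : ℝ), t ∈ Ioo (0 : ℝ) 1 := Ioo_mem_nhdsGT (by norm_num)
      filter_upwards [hev] with t ht
      have h5 := hF.convexOn.2 (mem_univ η) (mem_univ ξ) (sub_nonneg.2 ht.2.le) ht.1.le (by ring)
      have h6 : (1 - t) • η + t • ξ = η + t • (ξ - η) := by module
      rw [h6, h2] at h5
      simp only [smul_eq_mul] at h5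
      linarith)
  rw [h4] at h3
  nlinarith [hF.pos η hη]

theorem exists_eigenbasis (hF : IsStronglyConvexMinkowskiNormC3 F)
    {ξ : EuclideanSpace ℝ (Fin n)} (hξ : ξ ≠ 0) :
    ∃ (f : OrthonormalBasis (Fin n) ℝ (EuclideanSpace ℝ (Fin n))) (μ : Fin n → ℝ),
      (∀ k, fderiv ℝ (gradient F) ξ (f k) = μ k • f k) ∧ (∀ k, 0 ≤ μ k) ∧
      (∀ k, μ k ≠ 0 → ⟪ξ, f k⟫ = 0) ∧ ∃ k, μ k = 0 := by
  have hsym : (fderiv ℝ (gradient F) ξ).toLinearMap.IsSymmetric := fun v w =>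
    hF.inner_hessian_comm hξ v w
  have hn : Module.finrank ℝ (EuclideanSpace ℝ (Fin n)) = n := by simp
  have heig : ∀ k, fderiv ℝ (gradient F) ξ (hsym.eigenvectorBasis hn k) =
      hsym.eigenvalues hn k • hsym.eigenvectorBasis hn k := fun k =>
    hsym.apply_eigenvectorBasis hn k
  have horth : ∀ k, hsym.eigenvalues hn k ≠ 0 → ⟪ξ, hsym.eigenvectorBasis hn k⟫ = 0 := by
    intro k hk
    have h1 := hF.inner_hessian_comm hξ ξ (hsym.eigenvectorBasis hn k)
    rw [hF.hessian_self hξ, inner_zero_left, heig, real_inner_smul_right] at h1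
    exact (mul_eq_zero.1 h1.symm).resolve_left hk
  refine ⟨hsym.eigenvectorBasis hn, hsym.eigenvalues hn, heig, fun k => ?_, horth, ?_⟩
  · have h1 := hF.hessian_nonneg hξ (hsym.eigenvectorBasis hn k)
    rw [heig, real_inner_smul_left, real_inner_self_eq_norm_sq,
      (hsym.eigenvectorBasis hn).orthonormal.1 k] at h1
    simpa using h1
  · by_contra! hall
    refine hξ ?_
    rw [← (hsym.eigenvectorBasis hn).sum_repr' ξ]
    refine Finset.sum_eq_zero fun k _ => ?_
    rw [real_inner_comm, horth k (hall k), zero_smul]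

end IsStronglyConvexMinkowskiNormC3

section Regularity

variable {n : ℕ} {F : EuclideanSpace ℝ (Fin n) → ℝ} {Ω : Set (EuclideanSpace ℝ (Fin n))}
  {lam : ℝ} {u : EuclideanSpace ℝ (Fin n) → ℝ}

theorem IsStronglyConvexMinkowskiNormC3.continuous (hF : IsStronglyConvexMinkowskiNormC3 F) :
    Continuous F :=
  continuousOn_univ.1 (hF.convexOn.continuousOn isOpen_univ)

theorem IsStronglyConvexMinkowskiNormC3.eq_zero_of_map (hF : IsStronglyConvexMinkowskiNormC3 F)
    {ξ : EuclideanSpace ℝ (Fin n)} (h : F ξ = 0) : ξ = 0 := by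
  by_contra hne
  exact (hF.pos ξ hne).ne' h

theorem IsStronglyConvexMinkowskiNormC3.continuousAt_aCoeff
    (hF : IsStronglyConvexMinkowskiNormC3 F) {ξ : EuclideanSpace ℝ (Fin n)} (hξ : ξ ≠ 0)
    (i j : Fin n) : ContinuousAt (aCoeff F i j) ξ := by
  have h1 : aCoeff F i j =ᶠ[𝓝 ξ] fun ξ =>
      ⟪gradient F ξ, EuclideanSpace.single i 1⟫ *
      ⟪gradient F ξ, EuclideanSpace.single j 1⟫ + F ξ *
      ⟪fderiv ℝ (gradient F) ξ (EuclideanSpace.single j 1), EuclideanSpace.single i 1⟫ := by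
    filter_upwards [isOpen_compl_singleton.mem_nhds hξ] with η hη
    exact hF.aCoeff_eq hη i j
  refine ContinuousAt.congr ?_ h1.symm
  have h2 := (hF.contDiffAt_gradient hξ).continuousAt
  have h3 : ContinuousAt (fderiv ℝ (gradient F)) ξ :=
    ((hF.contDiffAt_gradient hξ).fderiv_right (m := 1) (by norm_num)).continuousAt
  have h4 := hF.continuous.continuousAt (x := ξ)
  have h5 := h3.clm_apply
    (continuousAt_const (y := (EuclideanSpace.single j 1 : EuclideanSpace ℝ (Fin n))))
  exact ((h2.inner continuousAt_const).mul (h2.inner continuousAt_const)).add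
    (h4.mul (h5.inner continuousAt_const))

theorem uniqueDiffOn_closure (hne : Ω.Nonempty) (hop : IsOpen Ω) (hconv : Convex ℝ Ω) :
    UniqueDiffOn ℝ (closure Ω) :=
  uniqueDiffOn_convex hconv.closure
    (hne.mono (interior_maximal subset_closure hop))

namespace IsNeumannEigenfunction

theorem exists_continuous_gradient (hu : IsNeumannEigenfunction F Ω lam u) (hne : Ω.Nonempty)
    (hop : IsOpen Ω) (hconv : Convex ℝ Ω) :
    ∃ G : EuclideanSpace ℝ (Fin n) → EuclideanSpace ℝ (Fin n), ContinuousOn G (closure Ω) ∧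
      ∀ x ∈ closure Ω, HasGradientWithinAt u (G x) (closure Ω) x := by
  have hU := uniqueDiffOn_closure hne hop hconv
  refine ⟨fun x => (InnerProductSpace.toDual ℝ _).symm (fderivWithin ℝ u (closure Ω) x), ?_, ?_⟩
  · exact (InnerProductSpace.toDual ℝ _).symm.continuous.comp_continuousOn
      (hu.contDiff1.continuousOn_fderivWithin hU le_rfl)
  · intro x hx
    rw [hasGradientWithinAt_iff_hasFDerivWithinAt, LinearIsometryEquiv.apply_symm_apply]
    exact ((hu.contDiff1.differentiableOn (by norm_num)) x hx).hasFDerivWithinAt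

theorem hasGradientWithinAt (hF : IsStronglyConvexMinkowskiNormC3 F)
    (hu : IsNeumannEigenfunction F Ω lam u) (hne : Ω.Nonempty)
    (hop : IsOpen Ω) (hconv : Convex ℝ Ω) {x : EuclideanSpace ℝ (Fin n)} (hx : x ∈ closure Ω) :
    HasGradientWithinAt u (gradient u x) (closure Ω) x := by
  have hU := uniqueDiffOn_closure hne hop hconv
  obtain ⟨G, hGc, hG⟩ := hu.exists_continuous_gradient hne hop hconv
  by_cases hd : DifferentiableAt ℝ u x
  · exact hasGradientWithinAt_iff_hasFDerivWithinAt.2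
      (hasGradientAt_iff_hasFDerivAt.1 hd.hasGradientAt).hasFDerivWithinAt
  have h0 : gradient u x = 0 := by
    simp [gradient, fderiv_zero_of_not_differentiableAt hd]
  have hGΩ : ∀ y ∈ Ω, gradient u y = G y := by
    intro y hy
    have hy' : closure Ω ∈ 𝓝 y := mem_of_superset (hop.mem_nhds hy) subset_closure
    have h1 := (hasGradientWithinAt_iff_hasFDerivWithinAt.1 (hG y (subset_closure hy))).hasFDerivAt
      hy'
    exact (hasGradientAt_iff_hasFDerivAt.2 h1).gradient
  have hne' : (𝓝[Ω] x).NeBot := mem_closure_iff_nhdsWithin_neBot.1 hx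
  have t1 : Tendsto (fun y => F (gradient u y) • gradient F (gradient u y)) (𝓝[Ω] x) (𝓝 0) := by
    have := (hu.fluxCont x hx).mono_left (nhdsWithin_mono x subset_closure)
    simpa [h0, hF.map_zero] using this
  have t2 : Tendsto G (𝓝[Ω] x) (𝓝 (G x)) :=
    (hGc x hx).mono_left (nhdsWithin_mono x subset_closure)
  have t3 := Filter.Tendsto.inner (𝕜 := ℝ) t1 t2
  have t4 : Tendsto (fun y => F (G y) ^ 2) (𝓝[Ω] x) (𝓝 (F (G x) ^ 2)) :=
    ((hF.continuous.tendsto _).comp t2).pow 2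
  have t5 : F (G x) ^ 2 = ⟪(0 : EuclideanSpace ℝ (Fin n)), G x⟫ := by
    refine tendsto_nhds_unique t4 (t3.congr' ?_)
    filter_upwards [self_mem_nhdsWithin] with y hy
    rw [hGΩ y hy]
    by_cases hz : G y = 0
    · simp [hz, hF.map_zero]
    · rw [real_inner_smul_left, hF.inner_gradient_self hz]
      ring
  rw [inner_zero_left] at t5
  have hGx : G x = 0 := hF.eq_zero_of_map (pow_eq_zero_iff two_ne_zero |>.1 t5)
  have := hG x hx
  rwa [hGx, ← h0] at this

theorem gradient_eq_of_hasGradientWithinAt (hF : IsStronglyConvexMinkowskiNormC3 F)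
    (hu : IsNeumannEigenfunction F Ω lam u) (hne : Ω.Nonempty)
    (hop : IsOpen Ω) (hconv : Convex ℝ Ω) {x g : EuclideanSpace ℝ (Fin n)} (hx : x ∈ closure Ω)
    (hg : HasGradientWithinAt u g (closure Ω) x) : gradient u x = g := by
  have h1 := hasGradientWithinAt_iff_hasFDerivWithinAt.1
    (hu.hasGradientWithinAt hF hne hop hconv hx)
  have h2 := hasGradientWithinAt_iff_hasFDerivWithinAt.1 hg
  exact (InnerProductSpace.toDual ℝ _).injective
    ((uniqueDiffOn_closure hne hop hconv x hx).eq h1 h2)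

theorem continuousOn_gradient (hF : IsStronglyConvexMinkowskiNormC3 F)
    (hu : IsNeumannEigenfunction F Ω lam u) (hne : Ω.Nonempty)
    (hop : IsOpen Ω) (hconv : Convex ℝ Ω) : ContinuousOn (gradient u) (closure Ω) := by
  obtain ⟨G, hGc, hG⟩ := hu.exists_continuous_gradient hne hop hconv
  exact hGc.congr fun x hx =>
    hu.gradient_eq_of_hasGradientWithinAt hF hne hop hconv hx (hG x hx)

/-- The gradient is differentiable within the closed domain off its zeros, and the equation holds
up to the boundary. -/
theorem exists_hessian (hF : IsStronglyConvexMinkowskiNormC3 F)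
    (hu : IsNeumannEigenfunction F Ω lam u) (hne : Ω.Nonempty)
    (hop : IsOpen Ω) (hconv : Convex ℝ Ω) {x : EuclideanSpace ℝ (Fin n)} (hx : x ∈ closure Ω)
    (hgx : gradient u x ≠ 0) :
    ∃ M : EuclideanSpace ℝ (Fin n) →L[ℝ] EuclideanSpace ℝ (Fin n),
      HasFDerivWithinAt (gradient u) M (closure Ω) x ∧
      ∑ i, ∑ j, aCoeff F i j (gradient u x) *
        ⟪M (EuclideanSpace.single j 1), EuclideanSpace.single i 1⟫ = -lam * u x := by
  have hgc := hu.continuousOn_gradient hF hne hop hconv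
  obtain ⟨U, hUo, hU⟩ := continuousOn_iff'.1 hgc {0}ᶜ isOpen_compl_singleton
  set S := {x ∈ closure Ω | gradient u x ≠ 0} with hS
  have hSU : S = closure Ω ∩ U := by
    rw [inter_comm, ← hU, inter_comm]; rfl
  have hxU : x ∈ U := (hSU ▸ (⟨hx, hgx⟩ : x ∈ S) : x ∈ closure Ω ∩ U).2
  have hSd : UniqueDiffOn ℝ S := hSU ▸ (uniqueDiffOn_closure hne hop hconv).inter hUo
  have hgrad : ∀ y ∈ S, HasFDerivWithinAt u
      ((InnerProductSpace.toDual ℝ (EuclideanSpace ℝ (Fin n))) (gradient u y)) S y :=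
    fun y hy => (hasGradientWithinAt_iff_hasFDerivWithinAt.1
      (hu.hasGradientWithinAt hF hne hop hconv hy.1)).mono fun z hz => hz.1
  have hC1 : ContDiffOn ℝ 1 (gradient u) S := by
    have h1 := hu.contDiff2.fderivWithin hSd (m := 1) (by norm_num)
    refine ((InnerProductSpace.toDual ℝ
      (EuclideanSpace ℝ (Fin n))).symm.toContinuousLinearEquiv.contDiff.comp_contDiffOn h1).congr
      fun y hy => ?_
    change gradient u y = (InnerProductSpace.toDual ℝ _).symm (fderivWithin ℝ u S y)
    rw [(hgrad y hy).fderivWithin (hSd y hy), LinearIsometryEquiv.symm_apply_apply]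
  have hSK : ∀ y ∈ S, S ∈ 𝓝[closure Ω] y := by
    intro y hy
    rw [hSU] at hy ⊢
    exact inter_mem_nhdsWithin _ (hUo.mem_nhds hy.2)
  set Φ : EuclideanSpace ℝ (Fin n) → ℝ := fun y => ∑ i, ∑ j, aCoeff F i j (gradient u y) *
    ⟪fderivWithin ℝ (gradient u) S y (EuclideanSpace.single j 1), EuclideanSpace.single i 1⟫
    with hΦ
  have hxS : x ∈ S := ⟨hx, hgx⟩
  have hcM := hC1.continuousOn_fderivWithin hSd le_rfl
  have hΦc : ContinuousOn Φ S := by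
    refine continuousOn_finsetSum _ fun i _ => continuousOn_finsetSum _ fun j _ => ?_
    refine ContinuousOn.mul ?_ ?_
    · intro y hy
      exact (hF.continuousAt_aCoeff hy.2 i j).comp_continuousWithinAt
        (hC1.continuousOn y hy)
    · exact (hcM.clm_apply continuousOn_const).inner continuousOn_const
  refine ⟨fderivWithin ℝ (gradient u) S x,
    ((hC1.differentiableOn (by norm_num)) x hxS).hasFDerivWithinAt.mono_of_mem_nhdsWithin
      (hSK x hxS), ?_⟩
  have hne' : (𝓝[Ω] x).NeBot := mem_closure_iff_nhdsWithin_neBot.1 hx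
  have hev : ∀ᶠ y in 𝓝[Ω] x, y ∈ Ω ∩ U :=
    inter_mem self_mem_nhdsWithin (mem_nhdsWithin_of_mem_nhds (hUo.mem_nhds hxU))
  have hle : 𝓝[Ω] x ≤ 𝓝[S] x := by
    refine le_inf nhdsWithin_le_nhds (le_principal_iff.2 ?_)
    filter_upwards [hev] with y hy
    rw [hSU]
    exact ⟨subset_closure hy.1, hy.2⟩
  have t1 : Tendsto Φ (𝓝[Ω] x) (𝓝 (Φ x)) := (hΦc x hxS).mono_left hle
  have t2 : Tendsto (fun y => -lam * u y) (𝓝[Ω] x) (𝓝 (-lam * u x)) :=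
    ((hu.contDiff2.continuousOn x hxS).mono_left hle).const_mul _
  refine tendsto_nhds_unique t1 (t2.congr' ?_)
  filter_upwards [hev] with y hy
  have hyS : y ∈ S := by rw [hSU]; exact ⟨subset_closure hy.1, hy.2⟩
  have hSn : S ∈ 𝓝 y := by
    filter_upwards [(hop.inter hUo).mem_nhds hy] with z hz
    rw [hSU]; exact ⟨subset_closure hz.1, hz.2⟩
  rw [← hu.eqn y hy.1 hyS.2]
  have hd : DifferentiableAt ℝ (gradient u) y :=
    ((hC1.differentiableOn (by norm_num)) y hyS).differentiableAt hSn
  simp only [hΦ, fderivWithin_of_mem_nhds hSn, pd_pd_eq_inner hd]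

end IsNeumannEigenfunction

end Regularity

section Boundary

variable {n : ℕ} {Ω K : Set (EuclideanSpace ℝ (Fin n))}

/-- Every curve leaving `y` with velocity `p` stays in `K` for a short time. -/
def IsInwardVelocity (K : Set (EuclideanSpace ℝ (Fin n))) (y p : EuclideanSpace ℝ (Fin n)) :
    Prop :=
  ∀ γ : ℝ → EuclideanSpace ℝ (Fin n), HasVelocity γ y p → ∀ᶠ τ in 𝓝[>] (0 : ℝ), γ τ ∈ K

theorem isInwardVelocity_of_mem_nhds {y : EuclideanSpace ℝ (Fin n)} (hy : K ∈ 𝓝 y)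
    (p : EuclideanSpace ℝ (Fin n)) : IsInwardVelocity K y p :=
  fun _ hγ => hγ.tendsto hy

theorem eventually_mem_Ioo_nhdsGT : ∀ᶠ t in 𝓝[>] (0 : ℝ), t ∈ Ioo (0 : ℝ) 1 :=
  Ioo_mem_nhdsGT (by norm_num)

theorem isInwardVelocity_sub (hK : Convex ℝ K) {y z : EuclideanSpace ℝ (Fin n)} (hy : y ∈ K)
    (hz : K ∈ 𝓝 z) : IsInwardVelocity K y (z - y) := by
  intro γ hγ
  have h1 : Tendsto (fun τ : ℝ => z + τ⁻¹ • (γ τ - y - τ • (z - y))) (𝓝[>] 0) (𝓝 z) := by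
    have h2 : Tendsto (fun τ : ℝ => τ⁻¹ • (γ τ - y - τ • (z - y))) (𝓝[>] 0) (𝓝 0) := by
      rw [tendsto_zero_iff_norm_tendsto_zero]
      have h3 := (isLittleO_norm_norm.2 hγ).tendsto_div_nhds_zero
      refine h3.congr fun τ => ?_
      rw [norm_smul, norm_inv]
      ring
    simpa using h2.const_add z
  filter_upwards [h1 hz, eventually_mem_Ioo_nhdsGT] with τ h3 h4
  have h5 := hK.add_smul_sub_mem hy h3 ⟨h4.1.le, h4.2.le⟩
  have h6 : y + τ • (z + τ⁻¹ • (γ τ - y - τ • (z - y)) - y) = γ τ := by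
    rw [smul_sub, smul_add, smul_inv_smul₀ h4.1.ne']
    module
  rwa [h6] at h5

theorem exists_strict_normal (hop : IsOpen Ω) (hconv : Convex ℝ Ω) (hsb : HasSmoothBoundary Ω)
    {x : EuclideanSpace ℝ (Fin n)} (hx : x ∈ frontier Ω) :
    ∃ ν, ν ≠ 0 ∧ (∀ z ∈ Ω, ⟪ν, z - x⟫ < 0) ∧ ∀ p, ⟪ν, p⟫ < 0 → IsInwardVelocity Ω x p := by
  obtain ⟨U, hU, f, hf, hfU, hfd⟩ := hsb x hx
  have hxΩ : x ∉ Ω := by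
    rw [hop.frontier_eq] at hx
    exact hx.2
  have hxU := mem_of_mem_nhds hU
  have hne := hfd x hxU hx
  have hd : HasFDerivAt f (fderiv ℝ f x) x := (hf.differentiable (by simp) x).hasFDerivAt
  have hfx : f x = 0 := by
    refine le_antisymm ?_ (not_lt.1 fun h => hxΩ ((hfU x hxU).2 h))
    have hne' : (𝓝[Ω] x).NeBot :=
      mem_closure_iff_nhdsWithin_neBot.1 (frontier_subset_closure hx)
    have t1 : Tendsto f (𝓝[Ω] x) (𝓝 (f x)) := hf.continuous.continuousWithinAt
    refine le_of_tendsto t1 ?_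
    filter_upwards [self_mem_nhdsWithin, mem_nhdsWithin_of_mem_nhds hU] with y h1 h2
    exact ((hfU y h2).1 h1).le
  have hvel : ∀ (γ : ℝ → EuclideanSpace ℝ (Fin n)) p, HasVelocity γ x p →
      (fun τ => f (γ τ) - ⟪gradient f x, p⟫ * τ) =o[𝓝[>] (0 : ℝ)] (fun τ : ℝ => τ) := by
    intro γ p hγ
    have := hγ.comp_hasFDerivWithinAt (K := univ) (by simp) hd.hasFDerivWithinAt
    refine IsLittleO.congr_left this fun τ => ?_
    rw [hfx, inner_gradient_left, smul_eq_mul]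
    ring
  have hle : ∀ z ∈ Ω, ⟪gradient f x, z - x⟫ ≤ 0 := by
    intro z hz
    have hv := HasVelocity.line x (z - x)
    refine nonpos_of_isLittleO_id (hvel _ _ hv) ?_
    filter_upwards [hv.tendsto hU, eventually_mem_Ioo_nhdsGT] with τ h1 h2
    refine ((hfU _ h1).1 ?_).le
    have h3 := hconv.add_smul_sub_mem_interior' (frontier_subset_closure hx)
      (hop.interior_eq.symm ▸ hz) ⟨h2.1, h2.2.le⟩
    exact interior_subset h3
  have hν : gradient f x ≠ 0 := by
    intro h
    apply hne
    ext v
    rw [← inner_gradient_left, h]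
    simp
  refine ⟨gradient f x, hν, ?_, ?_⟩
  · intro z hz
    have hv := HasVelocity.line z (gradient f x)
    obtain ⟨s, h1, h2⟩ := ((hv.tendsto.eventually_mem (hop.mem_nhds hz)).and
      eventually_mem_Ioo_nhdsGT).exists
    have h3 := hle _ h1
    have h4 : z + s • gradient f x - x = (z - x) + s • gradient f x := by module
    rw [h4, inner_add_right, real_inner_smul_right] at h3
    have h5 := real_inner_self_pos.2 hν
    nlinarith [h2.1]
  · intro p hp γ hγ
    have h1 := isLittleO_iff.1 (hvel γ p hγ) (show 0 < -⟪gradient f x, p⟫ / 2 by linarith)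
    filter_upwards [h1, hγ.tendsto hU, eventually_mem_Ioo_nhdsGT] with τ h2 h3 h4
    refine (hfU _ h3).2 ?_
    rw [Real.norm_eq_abs, Real.norm_eq_abs, abs_of_pos h4.1] at h2
    have h5 := (abs_le.1 h2).2
    nlinarith [h4.1]

/-- Two points of a convex domain on a line that is tangent to the boundary whenever it
meets it share their inward half-space. -/
theorem exists_common_inward (hop : IsOpen Ω) (hconv : Convex ℝ Ω) (hsb : HasSmoothBoundary Ω)
    {x y e : EuclideanSpace ℝ (Fin n)} (hx : x ∈ closure Ω) (hy : y ∈ closure Ω) {d : ℝ}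
    (hxy : y = x + d • e)
    (hNx : ∀ ν, ν ≠ 0 → (∀ z ∈ closure Ω, ⟪ν, z - x⟫ ≤ 0) → ⟪e, ν⟫ = 0)
    (hNy : ∀ ν, ν ≠ 0 → (∀ z ∈ closure Ω, ⟪ν, z - y⟫ ≤ 0) → ⟪e, ν⟫ = 0) :
    ∃ ν, ⟪e, ν⟫ = 0 ∧ ∀ (p : EuclideanSpace ℝ (Fin n)) (ρ : ℝ), 0 < ρ → ⟪ν, p⟫ ≤ 0 →
      IsInwardVelocity (closure Ω) y (p - ρ • ν) ∧
      IsInwardVelocity (closure Ω) x (p - ρ • ν) := by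
  have hmono : ∀ {z p : EuclideanSpace ℝ (Fin n)}, IsInwardVelocity Ω z p →
      IsInwardVelocity (closure Ω) z p := fun h γ hγ =>
    (h γ hγ).mono fun τ hτ => subset_closure hτ
  have hcl : ∀ {z ν : EuclideanSpace ℝ (Fin n)}, (∀ z' ∈ Ω, ⟪ν, z' - z⟫ < 0) →
      ∀ z' ∈ closure Ω, ⟪ν, z' - z⟫ ≤ 0 := by
    intro z ν h z' hz'
    have hc : IsClosed {z' : EuclideanSpace ℝ (Fin n) | ⟪ν, z' - z⟫ ≤ 0} :=
      isClosed_le (by fun_prop) continuous_const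
    exact closure_minimal (fun a ha => (h a ha).le) hc hz'
  have hfr : ∀ {z : EuclideanSpace ℝ (Fin n)}, z ∈ closure Ω → z ∉ Ω → z ∈ frontier Ω := by
    intro z h1 h2
    rw [hop.frontier_eq]
    exact ⟨h1, h2⟩
  by_cases hxΩ : x ∈ Ω
  · by_cases hyΩ : y ∈ Ω
    · exact ⟨0, inner_zero_right _, fun p ρ _ _ =>
        ⟨hmono (isInwardVelocity_of_mem_nhds (hop.mem_nhds hyΩ) _),
          hmono (isInwardVelocity_of_mem_nhds (hop.mem_nhds hxΩ) _)⟩⟩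
    · obtain ⟨ν, hν, hlt, -⟩ := exists_strict_normal hop hconv hsb (hfr hy hyΩ)
      have h1 := hNy ν hν (hcl hlt)
      have h2 := hlt x hxΩ
      have h3 : x - y = (-d) • e := by rw [hxy]; module
      rw [h3, real_inner_smul_right, real_inner_comm, h1] at h2
      simp at h2
  · obtain ⟨ν₁, hν₁, hlt₁, hin₁⟩ := exists_strict_normal hop hconv hsb (hfr hx hxΩ)
    have h1 := hNx ν₁ hν₁ (hcl hlt₁)
    have h4 : y - x = d • e := by rw [hxy]; module
    by_cases hyΩ : y ∈ Ω
    · have h2 := hlt₁ y hyΩ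
      rw [h4, real_inner_smul_right, real_inner_comm, h1] at h2
      simp at h2
    · obtain ⟨ν, hν, hlt, hin⟩ := exists_strict_normal hop hconv hsb (hfr hy hyΩ)
      refine ⟨ν, hNy ν hν (hcl hlt), fun p ρ hρ hp => ?_⟩
      have hneg : ⟪ν, p - ρ • ν⟫ < 0 := by
        rw [inner_sub_right, real_inner_smul_right]
        nlinarith [mul_pos hρ (real_inner_self_pos.2 hν)]
      refine ⟨hmono (hin _ hneg), hmono (hin₁ _ ?_)⟩
      obtain ⟨τ, h5, h6⟩ := ((hin _ hneg _ (HasVelocity.line y (p - ρ • ν))).and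
        eventually_mem_Ioo_nhdsGT).exists
      have h7 := hlt₁ _ h5
      have h8 : y + τ • (p - ρ • ν) - x = d • e + τ • (p - ρ • ν) := by rw [← h4]; module
      rw [h8, inner_add_right, real_inner_smul_right, real_inner_smul_right,
        real_inner_comm, h1] at h7
      nlinarith [h6.1]

end Boundary

section Contact

variable {n : ℕ} {F : EuclideanSpace ℝ (Fin n) → ℝ} {K : Set (EuclideanSpace ℝ (Fin n))}
  {w : EuclideanSpace ℝ (Fin n) → ℝ} {θ : ℝ → ℝ}

/-- `θ` is a modulus of continuity for `w` on `K` in terms of the dual norm of `F`; pairs of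
points are parametrised as `x`, `x + r ∇F(ξ)`. -/
def IsDualModulus (F : EuclideanSpace ℝ (Fin n) → ℝ) (K : Set (EuclideanSpace ℝ (Fin n)))
    (w : EuclideanSpace ℝ (Fin n) → ℝ) (θ : ℝ → ℝ) : Prop :=
  ∀ x ∈ K, ∀ ξ, ξ ≠ 0 → ∀ r, 0 < r → x + r • gradient F ξ ∈ K →
    w (x + r • gradient F ξ) - w x ≤ θ r

theorem IsDualModulus.neg (hF : IsStronglyConvexMinkowskiNormC3 F)
    (h : IsDualModulus F K w θ) : IsDualModulus F K (fun x => -w x) θ := by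
  intro x hx ξ hξ r hr hy
  have h1 : x + r • gradient F ξ + r • gradient F (-ξ) = x := by
    rw [hF.gradient_neg hξ]; module
  have h2 := h _ hy (-ξ) (neg_ne_zero.2 hξ) r hr (by rwa [h1])
  rw [h1] at h2
  linarith

/-- The Neumann condition at `y` for a function with gradient `G`. -/
def NeumannAt (F : EuclideanSpace ℝ (Fin n) → ℝ) (K : Set (EuclideanSpace ℝ (Fin n)))
    (y G : EuclideanSpace ℝ (Fin n)) : Prop :=
  G ≠ 0 → ∀ ν, ν ≠ 0 → (∀ z ∈ K, ⟪ν, z - y⟫ ≤ 0) → ⟪gradient F G, ν⟫ = 0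

theorem NeumannAt.neg (hF : IsStronglyConvexMinkowskiNormC3 F)
    {y G : EuclideanSpace ℝ (Fin n)} (h : NeumannAt F K y G) : NeumannAt F K y (-G) := by
  intro hG ν hν hle
  have hG' : G ≠ 0 := neg_ne_zero.1 hG
  rw [hF.gradient_neg hG', inner_neg_left, h hG' ν hν hle, neg_zero]

theorem NeumannAt.smul (hF : IsStronglyConvexMinkowskiNormC3 F)
    {y G : EuclideanSpace ℝ (Fin n)} (h : NeumannAt F K y G) {t : ℝ} (ht : 0 < t) :
    NeumannAt F K y (t • G) := by
  intro hG ν hν hle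
  have hG' : G ≠ 0 := (smul_ne_zero_iff.1 hG).2
  rw [hF.gradient_smul hG' ht, h hG' ν hν hle]

/-- First-order condition at the endpoint of an extremal pair. -/
theorem IsDualModulus.inner_sub_le (hF : IsStronglyConvexMinkowskiNormC3 F)
    (h : IsDualModulus F K w θ) {x y ξ G p : EuclideanSpace ℝ (Fin n)} {d : ℝ} (hx : x ∈ K)
    (hξ : ξ ≠ 0) (hd : 0 < d) (hxy : y = x + d • gradient F ξ)
    (heq : w y - w x = θ d) (hθ : HasDerivAt θ (F ξ) d) (hG : HasGradientWithinAt w G K y)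
    (hp : IsInwardVelocity K y p) : ⟪G - ξ, p⟫ ≤ 0 := by
  obtain ⟨b, hb⟩ := hF.exists_decomposition hξ p
  set r₁ := ⟪ξ, p⟫ / F ξ with hr₁
  have hc := hF.pos ξ hξ
  have hvr : HasVelocity (fun τ : ℝ => d + τ * r₁) d r₁ := by
    simpa using HasVelocity.line d r₁
  have hvγ : HasVelocity (fun τ => x + (d + τ * r₁) • gradient F (ξ + τ • (d⁻¹ • b))) y p := by
    have h1 := (hF.hasVelocity_gradient hξ (d⁻¹ • b)).smul hvr
    have h2 := (HasVelocity.line x 0).add h1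
    rw [map_smul, smul_inv_smul₀ hd.ne', ← hb, ← hxy] at h2
    simpa using h2
  have hvθ : HasVelocity (fun τ => θ (d + τ * r₁)) (θ d) (F ξ * r₁) := by
    have := hvr.comp_hasFDerivWithinAt (K := univ) (by simp) hθ.hasFDerivAt.hasFDerivWithinAt
    simpa [mul_comm] using this
  have hvw := hvγ.comp_hasFDerivWithinAt (hp _ hvγ)
    (hasGradientWithinAt_iff_hasFDerivWithinAt.1 hG)
  rw [InnerProductSpace.toDual_apply_apply] at hvw
  have h3 : F ξ * r₁ = ⟪ξ, p⟫ := by rw [hr₁]; field_simp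
  have h4 := IsLittleO.sub hvw hvθ
  rw [inner_sub_left, ← h3]
  refine nonpos_of_isLittleO_id (e := fun τ =>
    w (x + (d + τ * r₁) • gradient F (ξ + τ • (d⁻¹ • b))) - w x - θ (d + τ * r₁))
    (h4.congr_left fun τ => ?_) ?_
  · simp only [smul_eq_mul]
    linear_combination -heq
  · filter_upwards [hp _ hvγ, IsStronglyConvexMinkowskiNormC3.eventually_line_ne_zero hξ (d⁻¹ • b),
      hvr.tendsto.eventually_const_lt hd] with τ h5 h6 h7
    have := h x hx _ h6 _ h7 h5
    linarith

/-- At an extremal pair the gradient at the endpoint is the dual direction. -/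
theorem IsDualModulus.gradient_eq (hF : IsStronglyConvexMinkowskiNormC3 F) (hK : Convex ℝ K)
    (hKi : K ⊆ closure (interior K))
    (h : IsDualModulus F K w θ) {x y ξ G : EuclideanSpace ℝ (Fin n)} {d : ℝ} (hx : x ∈ K)
    (hy : y ∈ K) (hξ : ξ ≠ 0) (hd : 0 < d) (hxy : y = x + d • gradient F ξ)
    (heq : w y - w x = θ d) (hθ : HasDerivAt θ (F ξ) d) (hG : HasGradientWithinAt w G K y)
    (hN : NeumannAt F K y G) : G = ξ := by
  have h1 : ∀ z ∈ K, ⟪G - ξ, z - y⟫ ≤ 0 := by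
    intro z hz
    have hc : IsClosed {z : EuclideanSpace ℝ (Fin n) | ⟪G - ξ, z - y⟫ ≤ 0} :=
      isClosed_le (by fun_prop) continuous_const
    refine closure_minimal (fun a ha => ?_) hc (hKi hz)
    exact h.inner_sub_le hF hx hξ hd hxy heq hθ hG
      (isInwardVelocity_sub hK hy (mem_interior_iff_mem_nhds.1 ha))
  by_contra hne
  have hζ : G - ξ ≠ 0 := sub_ne_zero.2 hne
  have h2 := h1 x hx
  have h3 : x - y = (-d) • gradient F ξ := by rw [hxy]; module
  rw [h3, real_inner_smul_right] at h2
  have h4 : 0 ≤ ⟪G - ξ, gradient F ξ⟫ := by nlinarith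
  rw [inner_sub_left, real_inner_comm, real_inner_comm _ ξ, hF.inner_gradient_self hξ] at h4
  have hpos := hF.pos ξ hξ
  have hG0 : G ≠ 0 := by
    rintro rfl
    rw [inner_zero_right] at h4
    linarith
  have h5 := hN hG0 _ hζ h1
  rw [inner_sub_right, hF.inner_gradient_self hG0] at h5
  have h6 := hF.inner_gradient_le hξ G
  have h7 := hF.inner_gradient_le hG0 ξ
  exact hne (hF.eq_of_inner_gradient_eq hG0 (by linarith) (by linarith)).symm

/-- Second-order condition at an extremal pair. -/
theorem IsDualModulus.second_order (hF : IsStronglyConvexMinkowskiNormC3 F) (hK : Convex ℝ K)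
    (h : IsDualModulus F K w θ) {g : EuclideanSpace ℝ (Fin n) → EuclideanSpace ℝ (Fin n)}
    (hg : ∀ z ∈ K, HasGradientWithinAt w (g z) K z)
    {x y ξ : EuclideanSpace ℝ (Fin n)} {d : ℝ} (hx : x ∈ K)
    (hy : y ∈ K) (hξ : ξ ≠ 0) (hd : 0 < d) (hxy : y = x + d • gradient F ξ)
    (heq : w y - w x = θ d) (hgx : g x = ξ) (hgy : g y = ξ)
    {Hx Hy : EuclideanSpace ℝ (Fin n) →L[ℝ] EuclideanSpace ℝ (Fin n)}
    (hHx : HasFDerivWithinAt g Hx K x) (hHy : HasFDerivWithinAt g Hy K y)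
    {θ₂ r₁ : ℝ} (hθ : (fun τ : ℝ => θ (d + τ * r₁) - θ d - F ξ * r₁ * τ -
      θ₂ * r₁ ^ 2 / 2 * τ ^ 2) =o[𝓝[>] (0 : ℝ)] (fun τ : ℝ => τ ^ 2))
    {px py b : EuclideanSpace ℝ (Fin n)} (hpx : IsInwardVelocity K x px)
    (hpy : IsInwardVelocity K y py)
    (hp : py - px = r₁ • gradient F ξ + d • fderiv ℝ (gradient F) ξ b) :
    ⟪Hy py, py⟫ - ⟪Hx px, px⟫ ≤ d * ⟪fderiv ℝ (gradient F) ξ b, b⟫ + θ₂ * r₁ ^ 2 := by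
  have hvr : HasVelocity (fun τ : ℝ => d + τ * r₁) d r₁ := by
    simpa using HasVelocity.line d r₁
  have hvx := HasVelocity.line x px
  have hvy : HasVelocity (fun τ => x + τ • px + (d + τ * r₁) • gradient F (ξ + τ • b)) y py := by
    have h2 := hvx.add ((hF.hasVelocity_gradient hξ b).smul hvr)
    rw [← hp, ← hxy] at h2
    simpa using h2
  have hev : ∀ z, ∀ᶠ z' in 𝓝[K] z, HasGradientWithinAt w (g z') K z' := fun z =>
    eventually_mem_nhdsWithin.mono fun z' hz' => hg z' hz'
  have tx := taylor_two_curve hK hx (hev x) hHx hvx (hpx _ hvx)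
  have ty := taylor_two_curve hK hy (hev y) hHy hvy (hpy _ hvy)
  rw [hgx] at tx
  rw [hgy] at ty
  have tl := hF.inner_gradient_line hξ b
  have tl' : (fun τ : ℝ => (d + τ * r₁) * (⟪ξ, gradient F (ξ + τ • b)⟫ - F ξ +
      ⟪fderiv ℝ (gradient F) ξ b, b⟫ / 2 * τ ^ 2)) =o[𝓝[>] (0 : ℝ)] (fun τ : ℝ => τ ^ 2) := by
    simpa using (hvr.tendsto.isBigO_one ℝ).mul_isLittleO tl
  have t3 : (fun τ : ℝ => τ * τ ^ 2) =o[𝓝[>] (0 : ℝ)] (fun τ : ℝ => τ ^ 2) := by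
    have h1 : (fun τ : ℝ => τ) =o[𝓝[>] (0 : ℝ)] (fun _ => (1 : ℝ)) := by
      rw [isLittleO_one_iff]; exact tendsto_id_nhdsGT_zero
    simpa using h1.mul_isBigO (isBigO_refl (fun τ : ℝ => τ ^ 2) (𝓝[>] (0 : ℝ)))
  have hA := nonpos_of_isLittleO_sq (e := fun τ =>
    w (x + τ • px + (d + τ * r₁) • gradient F (ξ + τ • b)) - w (x + τ • px) - θ (d + τ * r₁))
    (A := ⟪Hy py, py⟫ / 2 - ⟪Hx px, px⟫ / 2 - d * ⟪fderiv ℝ (gradient F) ξ b, b⟫ / 2 -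
      θ₂ * r₁ ^ 2 / 2)
    (((((ty.sub tx).sub hθ).add tl').add
      (t3.const_mul_left (-(r₁ * ⟪fderiv ℝ (gradient F) ξ b, b⟫ / 2)))).congr_left fun τ => by
      have h1 : ⟪ξ, x + τ • px + (d + τ * r₁) • gradient F (ξ + τ • b) - y⟫ =
          ⟪ξ, x + τ • px - x⟫ + (d + τ * r₁) * ⟪ξ, gradient F (ξ + τ • b)⟫ - d * F ξ := by
        rw [hxy, ← hF.inner_gradient_self hξ]
        simp only [inner_sub_right, inner_add_right, real_inner_smul_right]
        rw [real_inner_comm ξ (gradient F ξ)]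
        ring
      rw [h1]
      linear_combination -heq) (by
    filter_upwards [hpx _ hvx, hpy _ hvy,
      IsStronglyConvexMinkowskiNormC3.eventually_line_ne_zero hξ b,
      hvr.tendsto.eventually_const_lt hd] with τ h4 h5 h6 h7
    have := h _ h4 _ h6 _ h7 h5
    linarith)
  linarith

end Contact

section ContactSum

variable {n : ℕ} {F : EuclideanSpace ℝ (Fin n) → ℝ} {K : Set (EuclideanSpace ℝ (Fin n))}
  {w : EuclideanSpace ℝ (Fin n) → ℝ} {θ : ℝ → ℝ}

theorem quadratic_le_of_perturbed
    {Hx Hy : EuclideanSpace ℝ (Fin n) →L[ℝ] EuclideanSpace ℝ (Fin n)}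
    {p q ν : EuclideanSpace ℝ (Fin n)} {C : ℝ}
    (h : ∀ ρ : ℝ, 0 < ρ → ⟪Hy (p - ρ • ν), p - ρ • ν⟫ - ⟪Hx (q - ρ • ν), q - ρ • ν⟫ ≤ C) :
    ⟪Hy p, p⟫ - ⟪Hx q, q⟫ ≤ C := by
  have hc : Continuous fun ρ : ℝ =>
      ⟪Hy (p - ρ • ν), p - ρ • ν⟫ - ⟪Hx (q - ρ • ν), q - ρ • ν⟫ := by fun_prop
  have ht := (hc.tendsto 0).mono_left (nhdsWithin_le_nhds (s := Ioi 0))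
  have := le_of_tendsto ht (eventually_mem_nhdsWithin.mono fun ρ hρ => h ρ hρ)
  simpa using this

/-- The trace form of the second-order condition at an extremal pair. -/
theorem IsDualModulus.sum_aCoeff_le (hF : IsStronglyConvexMinkowskiNormC3 F) (hK : Convex ℝ K)
    (h : IsDualModulus F K w θ) {g : EuclideanSpace ℝ (Fin n) → EuclideanSpace ℝ (Fin n)}
    (hg : ∀ z ∈ K, HasGradientWithinAt w (g z) K z)
    {x y ξ : EuclideanSpace ℝ (Fin n)} {d : ℝ} (hx : x ∈ K)
    (hy : y ∈ K) (hξ : ξ ≠ 0) (hd : 0 < d) (hxy : y = x + d • gradient F ξ)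
    (heq : w y - w x = θ d) (hgx : g x = ξ) (hgy : g y = ξ)
    {Hx Hy : EuclideanSpace ℝ (Fin n) →L[ℝ] EuclideanSpace ℝ (Fin n)}
    (hHx : HasFDerivWithinAt g Hx K x) (hHy : HasFDerivWithinAt g Hy K y)
    {θ₂ : ℝ} (hθ : ∀ r₁ : ℝ, (fun τ : ℝ => θ (d + τ * r₁) - θ d - F ξ * r₁ * τ -
      θ₂ * r₁ ^ 2 / 2 * τ ^ 2) =o[𝓝[>] (0 : ℝ)] (fun τ : ℝ => τ ^ 2))
    {ν : EuclideanSpace ℝ (Fin n)} (hν : ⟪gradient F ξ, ν⟫ = 0)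
    (hin : ∀ (p : EuclideanSpace ℝ (Fin n)) (ρ : ℝ), 0 < ρ → ⟪ν, p⟫ ≤ 0 →
      IsInwardVelocity K y (p - ρ • ν) ∧ IsInwardVelocity K x (p - ρ • ν))
    {α β : ℝ} (hα : 0 ≤ α) (hβ : 0 ≤ β) :
    β ^ 2 * (∑ i, ∑ j, aCoeff F i j ξ *
        ⟪Hy (EuclideanSpace.single j 1), EuclideanSpace.single i 1⟫) -
      α ^ 2 * (∑ i, ∑ j, aCoeff F i j ξ *
        ⟪Hx (EuclideanSpace.single j 1), EuclideanSpace.single i 1⟫) ≤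
      ((n : ℝ) - 1) * F ξ * (β - α) ^ 2 / d + θ₂ * (α + β) ^ 2 := by
  obtain ⟨f, μ, hf, hμ, -, k₀, hk₀⟩ := hF.exists_eigenbasis hξ
  have hpos := hF.pos ξ hξ
  have he : β ^ 2 * ⟪Hy (gradient F ξ), gradient F ξ⟫ -
      α ^ 2 * ⟪Hx (gradient F ξ), gradient F ξ⟫ ≤ θ₂ * (α + β) ^ 2 := by
    have h1 := quadratic_le_of_perturbed (Hx := Hx) (Hy := Hy) (p := β • gradient F ξ)
      (q := (-α) • gradient F ξ) (ν := ν) (C := θ₂ * (α + β) ^ 2) (fun ρ hρ => by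
      have hz : ∀ t : ℝ, ⟪ν, t • gradient F ξ⟫ ≤ 0 := fun t => by
        rw [real_inner_smul_right, real_inner_comm, hν, mul_zero]
      have := h.second_order hF hK hg hx hy hξ hd hxy heq hgx hgy hHx hHy (hθ (α + β))
        (hin _ ρ hρ (hz (-α))).2 (hin _ ρ hρ (hz β)).1 (b := 0) (by
          rw [_root_.map_zero]; module)
      simpa using this)
    simp only [map_smul, real_inner_smul_left, real_inner_smul_right] at h1
    linarith
  have hk : ∀ k, μ k * (β ^ 2 * ⟪Hy (f k), f k⟫ - α ^ 2 * ⟪Hx (f k), f k⟫) ≤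
      if k = k₀ then 0 else (β - α) ^ 2 / d := by
    intro k
    split_ifs with hkk
    · rw [hkk, hk₀, zero_mul]
    by_cases hμk : μ k = 0
    · rw [hμk, zero_mul]
      positivity
    have hμp : 0 < μ k := lt_of_le_of_ne (hμ k) (Ne.symm hμk)
    obtain ⟨s, hs, hsν⟩ : ∃ s : ℝ, s ^ 2 = 1 ∧ ⟪ν, s • f k⟫ ≤ 0 := by
      rcases le_total ⟪ν, f k⟫ 0 with h1 | h1
      · exact ⟨1, by norm_num, by simpa using h1⟩
      · exact ⟨-1, by norm_num, by simpa using h1⟩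
    have hz : ∀ t : ℝ, 0 ≤ t → ⟪ν, (t * s) • f k⟫ ≤ 0 := fun t ht => by
      rw [mul_smul, real_inner_smul_right]
      exact mul_nonpos_of_nonneg_of_nonpos ht hsν
    have h1 := quadratic_le_of_perturbed (Hx := Hx) (Hy := Hy) (p := (β * s) • f k)
      (q := (α * s) • f k) (ν := ν) (C := (β - α) ^ 2 / (d * μ k)) (fun ρ hρ => by
      have := h.second_order hF hK hg hx hy hξ hd hxy heq hgx hgy hHx hHy (hθ 0)
        (hin _ ρ hρ (hz α hα)).2 (hin _ ρ hρ (hz β hβ)).1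
        (b := ((β - α) * s / (d * μ k)) • f k) (by
          rw [map_smul, hf, smul_smul, smul_smul]
          have : d * ((β - α) * s / (d * μ k)) * μ k = β * s - α * s := by
            field_simp
          rw [this]
          module)
      refine this.trans_eq ?_
      rw [map_smul, hf, real_inner_smul_left, real_inner_smul_right, real_inner_smul_left,
        real_inner_self_eq_norm_sq, f.orthonormal.1 k]
      field_simp
      rw [hs]
      ring)
    simp only [map_smul, real_inner_smul_left, real_inner_smul_right] at h1
    have h2 : β ^ 2 * ⟪Hy (f k), f k⟫ - α ^ 2 * ⟪Hx (f k), f k⟫ ≤ (β - α) ^ 2 / (d * μ k) := by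
      refine le_trans (le_of_eq ?_) h1
      linear_combination -(β ^ 2 * ⟪Hy (f k), f k⟫ - α ^ 2 * ⟪Hx (f k), f k⟫) * hs
    refine (mul_le_mul_of_nonneg_left h2 hμp.le).trans_eq ?_
    field_simp
  have hsum : ∑ k, μ k * (β ^ 2 * ⟪Hy (f k), f k⟫ - α ^ 2 * ⟪Hx (f k), f k⟫) ≤
      ((n : ℝ) - 1) * ((β - α) ^ 2 / d) := by
    refine (Finset.sum_le_sum fun k _ => hk k).trans_eq ?_
    have h3 : ∀ k, (if k = k₀ then 0 else (β - α) ^ 2 / d) =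
        (β - α) ^ 2 / d - if k = k₀ then (β - α) ^ 2 / d else 0 := by
      intro k; split_ifs <;> ring
    simp only [h3, Finset.sum_sub_distrib, Finset.sum_const, Finset.card_univ, Fintype.card_fin,
      Finset.sum_ite_eq', Finset.mem_univ, if_true, nsmul_eq_mul]
    ring
  rw [hF.sum_aCoeff_inner hξ Hy f μ hf, hF.sum_aCoeff_inner hξ Hx f μ hf]
  have h4 : ∑ k, μ k * (β ^ 2 * ⟪Hy (f k), f k⟫ - α ^ 2 * ⟪Hx (f k), f k⟫) =
      β ^ 2 * ∑ k, μ k * ⟪Hy (f k), f k⟫ - α ^ 2 * ∑ k, μ k * ⟪Hx (f k), f k⟫ := by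
    rw [Finset.mul_sum, Finset.mul_sum, ← Finset.sum_sub_distrib]
    exact Finset.sum_congr rfl fun k _ => by ring
  rw [h4] at hsum
  have h5 := mul_le_mul_of_nonneg_left hsum hpos.le
  have h6 : F ξ * (((n : ℝ) - 1) * ((β - α) ^ 2 / d)) =
      ((n : ℝ) - 1) * F ξ * (β - α) ^ 2 / d := by ring
  rw [h6] at h5
  linarith

theorem IsStronglyConvexMinkowskiNormC3.aCoeff_smul (hF : IsStronglyConvexMinkowskiNormC3 F)
    {ξ : EuclideanSpace ℝ (Fin n)} (hξ : ξ ≠ 0) {t : ℝ} (ht : 0 < t) (i j : Fin n) :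
    aCoeff F i j (t • ξ) = aCoeff F i j ξ := by
  have hne : t • ξ ≠ 0 := smul_ne_zero ht.ne' hξ
  have h1 : HasFDerivAt (fun η => gradient F (t • η))
      ((fderiv ℝ (gradient F) (t • ξ)).comp (t • ContinuousLinearMap.id ℝ _)) ξ :=
    (hF.hasFDerivAt_gradient hne).comp ξ ((hasFDerivAt_id ξ).const_smul t)
  have h2 : (fun η => gradient F (t • η)) =ᶠ[𝓝 ξ] gradient F := by
    filter_upwards [isOpen_compl_singleton.mem_nhds hξ] with η hη
    exact hF.gradient_smul hη ht
  have h3 := h1.unique ((hF.hasFDerivAt_gradient hξ).congr_of_eventuallyEq h2)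
  have h4 : ∀ v, fderiv ℝ (gradient F) ξ v = t • fderiv ℝ (gradient F) (t • ξ) v := by
    intro v
    rw [← h3]
    simp
  rw [hF.aCoeff_eq hne, hF.aCoeff_eq hξ, hF.gradient_smul hξ ht, h4, hF.homog, abs_of_pos ht,
    real_inner_smul_left]
  ring

/-- The operator `Σ aᵢⱼ` applied to a Hessian of the form `s M + r ⟪g, ·⟫ g`. -/
theorem IsStronglyConvexMinkowskiNormC3.sum_aCoeff_add_rank_one
    (hF : IsStronglyConvexMinkowskiNormC3 F)
    {g : EuclideanSpace ℝ (Fin n)} (hg : g ≠ 0) {t : ℝ} (ht : 0 < t)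
    (M : EuclideanSpace ℝ (Fin n) →L[ℝ] EuclideanSpace ℝ (Fin n)) (s r : ℝ) :
    ∑ i, ∑ j, aCoeff F i j (t • g) *
      ⟪(s • M + (r • innerSL ℝ g).smulRight g) (EuclideanSpace.single j 1),
        EuclideanSpace.single i 1⟫ =
      s * (∑ i, ∑ j, aCoeff F i j g *
        ⟪M (EuclideanSpace.single j 1), EuclideanSpace.single i 1⟫) + r * F g ^ 2 := by
  have h1 := hF.sum_aCoeff_quadratic hg g
  rw [hF.hessian_self hg, inner_zero_left, mul_zero, add_zero, hF.inner_gradient_self hg] at h1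
  rw [← h1]
  simp only [Finset.mul_sum, ← Finset.sum_add_distrib]
  refine Finset.sum_congr rfl fun i _ => Finset.sum_congr rfl fun j _ => ?_
  rw [hF.aCoeff_smul hg ht]
  have h2 : ∀ i, ⟪g, EuclideanSpace.single i (1 : ℝ)⟫ = g i := fun i => by
    simp [EuclideanSpace.inner_single_right]
  simp [inner_add_left, real_inner_smul_left, h2]
  ring

end ContactSum

section Scalar

/-- Second-order expansion of a real function along a line. -/
theorem taylor_two_real {f f' : ℝ → ℝ} {d f₂ : ℝ} (hf : ∀ᶠ t in 𝓝 d, HasDerivAt f (f' t) t)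
    (hf' : HasDerivAt f' f₂ d) (r : ℝ) :
    (fun τ : ℝ => f (d + τ * r) - f d - f' d * r * τ - f₂ * r ^ 2 / 2 * τ ^ 2)
      =o[𝓝[>] (0 : ℝ)] (fun τ : ℝ => τ ^ 2) := by
  have h := taylor_two_curve (K := univ) convex_univ (mem_univ d) (f := f) (g := f')
    (H := ContinuousLinearMap.toSpanSingleton ℝ f₂) (by
      rw [nhdsWithin_univ]
      filter_upwards [hf] with t ht
      exact hasGradientWithinAt_univ.2 (HasDerivAt.hasGradientAt' ht))
    hf'.hasFDerivAt.hasFDerivWithinAt (HasVelocity.line d r) (by simp)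
  refine h.congr_left fun τ => ?_
  simp
  ring

theorem hasDerivAt_add_sqrt (δ : ℝ) {d : ℝ} (hd : 0 < d) :
    HasDerivAt (fun t : ℝ => t + δ * √t) (1 + δ / (2 * √d)) d := by
  have := (hasDerivAt_id d).add ((Real.hasDerivAt_sqrt hd.ne').const_mul δ)
  refine this.congr_deriv ?_
  ring

theorem hasDerivAt_one_add_div_sqrt (δ : ℝ) {d : ℝ} (hd : 0 < d) :
    HasDerivAt (fun t : ℝ => 1 + δ / (2 * √t)) (-δ / (4 * √d ^ 3)) d := by
  have hs : 0 < √d := Real.sqrt_pos.2 hd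
  have := ((((Real.hasDerivAt_sqrt hd.ne').const_mul 2).inv (by positivity)).const_mul
    δ).const_add 1
  refine (this.congr_deriv ?_)
  field_simp
  norm_num

theorem taylor_two_add_sqrt (δ : ℝ) {d : ℝ} (hd : 0 < d) (r : ℝ) :
    (fun τ : ℝ => (fun t : ℝ => t + δ * √t) (d + τ * r) - (fun t : ℝ => t + δ * √t) d -
      (1 + δ / (2 * √d)) * r * τ - -δ / (4 * √d ^ 3) * r ^ 2 / 2 * τ ^ 2)
      =o[𝓝[>] (0 : ℝ)] (fun τ : ℝ => τ ^ 2) :=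
  taylor_two_real (f' := fun t => 1 + δ / (2 * √t))
    ((eventually_gt_nhds hd).mono fun _ ht => hasDerivAt_add_sqrt δ ht)
    (hasDerivAt_one_add_div_sqrt δ hd) r

/-- The modulus `t + δ √t` is a strict supersolution for small `δ`. -/
theorem exists_strict_modulus {K₀ k₀ m ε₀ R : ℝ} (hK₀ : 0 ≤ K₀) (hk₀ : 0 < k₀) (hm : 0 ≤ m)
    (hε₀ : 0 < ε₀) (hR : 0 < R) :
    ∃ δ₀ : ℝ, 0 < δ₀ ∧ ∀ δ : ℝ, 0 < δ → δ ≤ δ₀ → ∀ r : ℝ, 0 < r → r ≤ R →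
      m * (1 + δ / (2 * r)) * (r ^ 2 + δ * r) ^ 2 / r ^ 2 + -δ / (4 * r ^ 3) * k₀ +
        2 * K₀ * ((1 + δ / (2 * r)) ^ 2 - 1) <
      (1 + δ / (2 * r)) ^ 2 * ((m + ε₀) * (r ^ 2 + δ * r)) := by
  set r₀ : ℝ := min 1 (k₀ / (16 * K₀ + 8 * m + 8)) with hr₀
  have hr₀pos : 0 < r₀ := lt_min one_pos (by positivity)
  set B : ℝ := 2 * K₀ * (R ^ 2 + R) + m / 2 * (R + 1) ^ 2 * R ^ 2 + 1 with hB
  have hBpos : 0 < B := by positivity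
  refine ⟨min 1 (ε₀ * r₀ ^ 5 / B), lt_min one_pos (by positivity), ?_⟩
  intro δ hδ hδle r hr hrR
  have hδ1 : δ ≤ 1 := hδle.trans (min_le_left _ _)
  have hδB : δ * B ≤ ε₀ * r₀ ^ 5 := (le_div_iff₀ hBpos).1 (hδle.trans (min_le_right _ _))
  have key : δ * (2 * K₀ * (r ^ 2 + δ * r / 4) + m / 2 * (r + δ / 2) * (r + δ) * r ^ 2) <
      δ * k₀ / 4 + ε₀ * r ^ 4 * (r + δ) := by
    have e1 : 2 * K₀ * (r ^ 2 + δ * r / 4) + m / 2 * (r + δ / 2) * (r + δ) * r ^ 2 ≤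
        2 * K₀ * (r ^ 2 + r) + m / 2 * (r + 1) ^ 2 * r ^ 2 := by
      have a1 : δ * r / 4 ≤ r := by nlinarith
      have a2 : (r + δ / 2) * (r + δ) ≤ (r + 1) ^ 2 := by
        rw [pow_two]; gcongr; linarith
      have a3 : m / 2 * (r + δ / 2) * (r + δ) * r ^ 2 =
        m / 2 * ((r + δ / 2) * (r + δ)) * r ^ 2 := by ring
      rw [a3]
      gcongr
    rcases le_total r r₀ with h | h
    · have hr1 : r ≤ 1 := h.trans (min_le_left _ _)
      have hrk : r * (16 * K₀ + 8 * m + 8) ≤ k₀ :=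
        (le_div_iff₀ (by positivity)).1 (h.trans (min_le_right _ _))
      have e2 : 2 * K₀ * (r ^ 2 + r) + m / 2 * (r + 1) ^ 2 * r ^ 2 ≤ r * (4 * K₀ + 2 * m) := by
        have b1 : r ^ 2 ≤ r := by nlinarith
        have b2 : (r + 1) ^ 2 ≤ 4 := by nlinarith
        calc 2 * K₀ * (r ^ 2 + r) + m / 2 * (r + 1) ^ 2 * r ^ 2
            ≤ 2 * K₀ * (r + r) + m / 2 * 4 * r := by gcongr
          _ = r * (4 * K₀ + 2 * m) := by ring
      have e3 : 2 * K₀ * (r ^ 2 + δ * r / 4) + m / 2 * (r + δ / 2) * (r + δ) * r ^ 2 < k₀ / 4 := by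
        nlinarith
      have e4 : 0 < ε₀ * r ^ 4 * (r + δ) := by positivity
      nlinarith
    · have e2 : 2 * K₀ * (r ^ 2 + r) + m / 2 * (r + 1) ^ 2 * r ^ 2 ≤ B := by
        have : 2 * K₀ * (r ^ 2 + r) + m / 2 * (r + 1) ^ 2 * r ^ 2 ≤
            2 * K₀ * (R ^ 2 + R) + m / 2 * (R + 1) ^ 2 * R ^ 2 := by gcongr
        linarith
      have e3 : ε₀ * r₀ ^ 5 ≤ ε₀ * r ^ 4 * (r + δ) := by
        have : r₀ ^ 5 ≤ r ^ 5 := by gcongr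
        have h4 : 0 < ε₀ * r ^ 4 * δ := by positivity
        nlinarith
      have e5 : δ * (2 * K₀ * (r ^ 2 + δ * r / 4) + m / 2 * (r + δ / 2) * (r + δ) * r ^ 2) ≤
        δ * B := mul_le_mul_of_nonneg_left (e1.trans e2) hδ.le
      have e6 : 0 < δ * k₀ / 4 := by positivity
      linarith
  have hc : (1 + δ / (2 * r)) ^ 2 * (ε₀ * (r ^ 2 + δ * r)) ≥ ε₀ * (r ^ 2 + δ * r) := by
    have h1 : 1 ≤ (1 + δ / (2 * r)) ^ 2 := by
      have : 0 < δ / (2 * r) := by positivity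
      nlinarith
    exact le_mul_of_one_le_left (by positivity) h1
  have hid : m * (1 + δ / (2 * r)) * (r ^ 2 + δ * r) ^ 2 / r ^ 2 + -δ / (4 * r ^ 3) * k₀ +
        2 * K₀ * ((1 + δ / (2 * r)) ^ 2 - 1) -
      (1 + δ / (2 * r)) ^ 2 * (m * (r ^ 2 + δ * r)) - ε₀ * (r ^ 2 + δ * r) =
      (δ * (2 * K₀ * (r ^ 2 + δ * r / 4) + m / 2 * (r + δ / 2) * (r + δ) * r ^ 2) -
      (δ * k₀ / 4 + ε₀ * r ^ 4 * (r + δ))) / r ^ 3 := by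
    field_simp
    ring
  have hneg : (δ * (2 * K₀ * (r ^ 2 + δ * r / 4) + m / 2 * (r + δ / 2) * (r + δ) * r ^ 2) -
      (δ * k₀ / 4 + ε₀ * r ^ 4 * (r + δ))) / r ^ 3 < 0 :=
    div_neg_of_neg_of_pos (by linarith) (by positivity)
  nlinarith

end Scalar

/-- A strict one-dimensional barrier on `[p, q]`. -/
structure IsStrictBarrier (n : ℕ) (lam : ℝ) (V V₁ V₂ ω : ℝ → ℝ) (p q m ε₀ : ℝ) : Prop where
  lt : p < q
  hasDerivAt : ∀ t ∈ Icc p q, HasDerivAt V (V₁ t) t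
  hasDerivAt₁ : ∀ t ∈ Icc p q, HasDerivAt V₁ (V₂ t) t
  pos : ∀ t ∈ Icc p q, 0 < V₁ t
  weight_cont : ContinuousOn ω (Icc p q)
  weight_pos : ∀ t ∈ Icc p q, 0 < ω t
  m_nonneg : 0 ≤ m
  gap_pos : 0 < ε₀
  weight_sub : ∀ s ∈ Icc p q, ∀ t ∈ Icc p q, ((n : ℝ) - 1) * (ω t - ω s) ^ 2 ≤ m * (t - s) ^ 2
  strict : ∀ s ∈ Icc p q, ∀ t ∈ Icc p q, s ≤ t → (m + ε₀) * (t - s) ≤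
    ω t ^ 2 * (-(lam * V t + V₂ t) / V₁ t) - ω s ^ 2 * (-(lam * V s + V₂ s) / V₁ s)

namespace IsStrictBarrier

variable {n : ℕ} {lam p q m ε₀ : ℝ} {V V₁ V₂ ω : ℝ → ℝ}

theorem strictMonoOn (h : IsStrictBarrier n lam V V₁ V₂ ω p q m ε₀) :
    StrictMonoOn V (Icc p q) := by
  refine strictMonoOn_of_deriv_pos (convex_Icc p q)
    (fun t ht => (h.hasDerivAt t ht).continuousAt.continuousWithinAt) fun t ht => ?_
  rw [interior_Icc] at ht
  rw [(h.hasDerivAt t (Ioo_subset_Icc_self ht)).deriv]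
  exact h.pos t (Ioo_subset_Icc_self ht)

theorem exists_inverse (h : IsStrictBarrier n lam V V₁ V₂ ω p q m ε₀) :
    ∃ W : ℝ → ℝ, ∀ s ∈ Ioo (V p) (V q), W s ∈ Ioo p q ∧ V (W s) = s ∧
      HasDerivAt W (V₁ (W s))⁻¹ s := by
  have hmono := h.strictMonoOn
  have hcont : ContinuousOn V (Icc p q) := fun t ht =>
    (h.hasDerivAt t ht).continuousAt.continuousWithinAt
  have hex : ∀ s, ∃ t, s ∈ Ioo (V p) (V q) → t ∈ Ioo p q ∧ V t = s := by
    intro s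
    by_cases hs : s ∈ Ioo (V p) (V q)
    · obtain ⟨t, ht, hts⟩ := intermediate_value_Ioo h.lt.le hcont hs
      exact ⟨t, fun _ => ⟨ht, hts⟩⟩
    · exact ⟨0, fun h => absurd h hs⟩
  choose W hW using hex
  have hWmono : MonotoneOn W (Ioo (V p) (V q)) := by
    intro s hs t ht hst
    by_contra! hlt
    have := hmono (Ioo_subset_Icc_self (hW t ht).1) (Ioo_subset_Icc_self (hW s hs).1) hlt
    rw [(hW t ht).2, (hW s hs).2] at this
    exact absurd hst (not_le.2 this)
  refine ⟨W, fun s hs => ⟨(hW s hs).1, (hW s hs).2, ?_⟩⟩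
  have hnhds : Ioo (V p) (V q) ∈ 𝓝 s := Ioo_mem_nhds hs.1 hs.2
  have himg : W '' Ioo (V p) (V q) ∈ 𝓝 (W s) := by
    refine mem_of_superset (Ioo_mem_nhds (hW s hs).1.1 (hW s hs).1.2) fun t ht => ?_
    have hVt : V t ∈ Ioo (V p) (V q) :=
      ⟨hmono ⟨le_rfl, h.lt.le⟩ (Ioo_subset_Icc_self ht) ht.1,
        hmono (Ioo_subset_Icc_self ht) ⟨h.lt.le, le_rfl⟩ ht.2⟩
    exact ⟨V t, hVt, hmono.injOn (Ioo_subset_Icc_self (hW _ hVt).1) (Ioo_subset_Icc_self ht)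
      (hW _ hVt).2⟩
  have hWs := Ioo_subset_Icc_self (hW s hs).1
  refine HasDerivAt.of_local_left_inverse
    (continuousAt_of_monotoneOn_of_image_mem_nhds hWmono hnhds himg)
    (h.hasDerivAt _ hWs) (h.pos _ hWs).ne' ?_
  filter_upwards [hnhds] with t ht
  exact (hW t ht).2

end IsStrictBarrier

section Contact

variable {n : ℕ} {lam p q m ε₀ : ℝ} {V V₁ V₂ ω W : ℝ → ℝ}
  {F u : EuclideanSpace ℝ (Fin n) → ℝ} {Ω K : Set (EuclideanSpace ℝ (Fin n))}

theorem HasGradientWithinAt.comp_hasDerivAt {f : ℝ → ℝ} {f' : ℝ}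
    {g x : EuclideanSpace ℝ (Fin n)} (hu : HasGradientWithinAt u g K x)
    (hf : HasDerivAt f f' (u x)) :
    HasGradientWithinAt (fun z => f (u z)) (f' • g) K x := by
  rw [hasGradientWithinAt_iff_hasFDerivWithinAt] at hu ⊢
  refine (hf.comp_hasFDerivWithinAt x hu).congr_fderiv ?_
  rw [map_smul]

theorem HasFDerivWithinAt.comp_smul_gradient {ψ : ℝ → ℝ} {ψ' : ℝ}
    {g : EuclideanSpace ℝ (Fin n) → EuclideanSpace ℝ (Fin n)} {x : EuclideanSpace ℝ (Fin n)}
    {M : EuclideanSpace ℝ (Fin n) →L[ℝ] EuclideanSpace ℝ (Fin n)}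
    (hu : HasGradientWithinAt u (g x) K x) (hg : HasFDerivWithinAt g M K x)
    (hψ : HasDerivAt ψ ψ' (u x)) :
    HasFDerivWithinAt (fun z => ψ (u z) • g z)
      (ψ (u x) • M + (ψ' • innerSL ℝ (g x)).smulRight (g x)) K x := by
  have h := (hu.comp_hasDerivAt hψ)
  rw [hasGradientWithinAt_iff_hasFDerivWithinAt] at h
  refine (h.smul hg).congr_fderiv ?_
  ext v
  simp

theorem IsNeumannEigenfunction.neumannAt (hu : IsNeumannEigenfunction F Ω lam u)
    (hop : IsOpen Ω) {z : EuclideanSpace ℝ (Fin n)} (hz : z ∈ closure Ω) :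
    NeumannAt F (closure Ω) z (gradient u z) := by
  intro hG ν hν hν'
  by_cases hzΩ : z ∈ Ω
  · exfalso
    obtain ⟨s, hs, hs'⟩ := Metric.isOpen_iff.1 hop z hzΩ
    have hνp : 0 < ‖ν‖ := norm_pos_iff.2 hν
    have hz' : z + (s / (2 * ‖ν‖)) • ν ∈ Ω := by
      apply hs'
      rw [mem_ball_iff_norm, add_sub_cancel_left, norm_smul, Real.norm_eq_abs,
        abs_of_pos (by positivity)]
      field_simp
      linarith
    have := hν' _ (subset_closure hz')
    rw [add_sub_cancel_left, inner_smul_right, real_inner_self_eq_norm_sq] at this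
    have : 0 < s / (2 * ‖ν‖) * ‖ν‖ ^ 2 := by positivity
    linarith
  · exact hu.neumann z ⟨hz, fun h => hzΩ (interior_subset h)⟩ hG ν hν hν'

namespace IsStrictBarrier

/-- The derivative of `s ↦ W (κ s)` where `W` inverts `V`. -/
theorem hasDerivAt_inverse_mul {κ s : ℝ}
    (hW : ∀ s ∈ Ioo (V p) (V q), W s ∈ Ioo p q ∧ V (W s) = s ∧
      HasDerivAt W (V₁ (W s))⁻¹ s) (hs : κ * s ∈ Ioo (V p) (V q)) :
    HasDerivAt (fun s => W (κ * s)) ((V₁ (W (κ * s)))⁻¹ * κ) s :=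
  HasDerivAt.comp s (hW _ hs).2.2 (hasDerivAt_const_mul κ)

theorem hasDerivAt_inverse_mul_deriv (h : IsStrictBarrier n lam V V₁ V₂ ω p q m ε₀) {κ s : ℝ}
    (hW : ∀ s ∈ Ioo (V p) (V q), W s ∈ Ioo p q ∧ V (W s) = s ∧
      HasDerivAt W (V₁ (W s))⁻¹ s) (hs : κ * s ∈ Ioo (V p) (V q)) :
    HasDerivAt (fun s => (V₁ (W (κ * s)))⁻¹ * κ)
      (-(κ ^ 2 * V₂ (W (κ * s)) / V₁ (W (κ * s)) ^ 3)) s := by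
  have hm := Ioo_subset_Icc_self (hW _ hs).1
  have h1 := ((h.hasDerivAt₁ _ hm).comp s (hasDerivAt_inverse_mul hW hs)).inv
    (h.pos _ hm).ne'
  refine (h1.mul_const κ).congr_deriv ?_
  have := (h.pos _ hm).ne'
  simp only [Function.comp]
  field_simp

/-- The scalar inequality resulting from the second-order conditions at a contact point. -/
theorem contact_le (h : IsStrictBarrier n lam V V₁ V₂ ω p q m ε₀) {s₁ s₂ δ d K₀ k₀ : ℝ}
    (hs1 : s₁ ∈ Icc p q) (hs2 : s₂ ∈ Icc p q) (hle : s₁ ≤ s₂) (heq : s₂ - s₁ = d + δ * √d)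
    (hδ : 0 < δ) (hd : 0 < d)
    (hK₀ : ∀ t ∈ Icc p q, |ω t ^ 2 * (lam * V t / V₁ t)| ≤ K₀)
    (hk₀ : ∀ s ∈ Icc p q, ∀ t ∈ Icc p q, k₀ ≤ (ω s + ω t) ^ 2)
    (hmain : ω s₂ ^ 2 * (-(lam * V s₂ / V₁ s₂) - (1 + δ / (2 * √d)) ^ 2 * (V₂ s₂ / V₁ s₂)) -
      ω s₁ ^ 2 * (-(lam * V s₁ / V₁ s₁) - (1 + δ / (2 * √d)) ^ 2 * (V₂ s₁ / V₁ s₁)) ≤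
      ((n : ℝ) - 1) * (1 + δ / (2 * √d)) * (ω s₂ - ω s₁) ^ 2 / d +
        -δ / (4 * √d ^ 3) * (ω s₁ + ω s₂) ^ 2) :
    (1 + δ / (2 * √d)) ^ 2 * ((m + ε₀) * (d + δ * √d)) ≤
      m * (1 + δ / (2 * √d)) * (d + δ * √d) ^ 2 / d + -δ / (4 * √d ^ 3) * k₀ +
        2 * K₀ * ((1 + δ / (2 * √d)) ^ 2 - 1) := by
  have hsd : 0 < √d := Real.sqrt_pos.2 hd
  have hcd : 0 < δ / (2 * √d) := by positivity
  have hstrict := h.strict s₁ hs1 s₂ hs2 hle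
  have hwt := h.weight_sub s₁ hs1 s₂ hs2
  rw [heq] at hstrict hwt
  have hθ₂ : -δ / (4 * √d ^ 3) * (ω s₁ + ω s₂) ^ 2 ≤ -δ / (4 * √d ^ 3) * k₀ :=
    mul_le_mul_of_nonpos_left (hk₀ s₁ hs1 s₂ hs2)
      (div_nonpos_of_nonpos_of_nonneg (by linarith) (by positivity))
  have hb1 := (abs_le.1 (hK₀ s₁ hs1))
  have hb2 := (abs_le.1 (hK₀ s₂ hs2))
  generalize -δ / (4 * √d ^ 3) * (ω s₁ + ω s₂) ^ 2 = e₁ at *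
  generalize -δ / (4 * √d ^ 3) * k₀ = e₂ at *
  generalize d + δ * √d = θ at *
  obtain ⟨c, hc⟩ : ∃ c, c = 1 + δ / (2 * √d) := ⟨_, rfl⟩
  rw [← hc] at hmain ⊢
  have hc1 : 1 < c := by linarith
  have hA : ((n : ℝ) - 1) * c * (ω s₂ - ω s₁) ^ 2 / d ≤ m * c * θ ^ 2 / d := by
    have : ((n : ℝ) - 1) * (ω s₂ - ω s₁) ^ 2 * c ≤ m * θ ^ 2 * c :=
      mul_le_mul_of_nonneg_right hwt (by linarith)
    gcongr ?_ / d
    linarith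
  have hc2 : 0 < c ^ 2 - 1 := by nlinarith
  have hB := mul_le_mul_of_nonneg_left hstrict (sq_nonneg c)
  have hC : (c ^ 2 - 1) * (ω s₁ ^ 2 * (lam * V s₁ / V₁ s₁) - ω s₂ ^ 2 * (lam * V s₂ / V₁ s₂)) ≤
      (c ^ 2 - 1) * (2 * K₀) := mul_le_mul_of_nonneg_left (by linarith) hc2.le
  have hD : ∀ s, -(lam * V s + V₂ s) / V₁ s = -(lam * V s / V₁ s) - V₂ s / V₁ s :=
    fun s => by ring
  rw [hD, hD] at hB
  generalize m * c * θ ^ 2 / d = e₃ at *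
  generalize ((n : ℝ) - 1) * c * (ω s₂ - ω s₁) ^ 2 / d = e₄ at *
  generalize lam * V s₁ / V₁ s₁ = a₁ at *
  generalize lam * V s₂ / V₁ s₂ = a₂ at *
  generalize V₂ s₁ / V₁ s₁ = b₁ at *
  generalize V₂ s₂ / V₁ s₂ = b₂ at *
  linear_combination hmain + hA + hB + hC + hθ₂

/-- The modulus `t + δ √t` has no contact pair. -/
theorem not_contact (h : IsStrictBarrier n lam V V₁ V₂ ω p q m ε₀)
    (hW : ∀ s ∈ Ioo (V p) (V q), W s ∈ Ioo p q ∧ V (W s) = s ∧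
      HasDerivAt W (V₁ (W s))⁻¹ s)
    (hne : Ω.Nonempty) (hop : IsOpen Ω) (hconv : Convex ℝ Ω) (hsb : HasSmoothBoundary Ω)
    (hF : IsStronglyConvexMinkowskiNormC3 F) (hu : IsNeumannEigenfunction F Ω lam u)
    {κ : ℝ} (hκ : 0 < κ) (hr : ∀ x ∈ closure Ω, κ * u x ∈ Ioo (V p) (V q))
    {δ K₀ k₀ d : ℝ} (hδ : 0 < δ) (hd : 0 < d)
    (hK₀ : ∀ t ∈ Icc p q, |ω t ^ 2 * (lam * V t / V₁ t)| ≤ K₀)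
    (hk₀ : ∀ s ∈ Icc p q, ∀ t ∈ Icc p q, k₀ ≤ (ω s + ω t) ^ 2)
    (hδ₀ : m * (1 + δ / (2 * √d)) * (d + δ * √d) ^ 2 / d + -δ / (4 * √d ^ 3) * k₀ +
        2 * K₀ * ((1 + δ / (2 * √d)) ^ 2 - 1) <
      (1 + δ / (2 * √d)) ^ 2 * ((m + ε₀) * (d + δ * √d)))
    (hmod : IsDualModulus F (closure Ω) (fun x => W (κ * u x)) (fun t => t + δ * √t))
    {x y ξ : EuclideanSpace ℝ (Fin n)} (hx : x ∈ closure Ω) (hy : y ∈ closure Ω) (hξ : ξ ≠ 0)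
    (hxy : y = x + d • gradient F ξ)
    (heq : W (κ * u y) - W (κ * u x) = d + δ * √d) : False := by
  set c : ℝ := 1 + δ / (2 * √d) with hc
  have hsd : 0 < √d := Real.sqrt_pos.2 hd
  have hcd : 0 < δ / (2 * √d) := by positivity
  have hc1 : 1 < c := by linarith
  have hFξ : 0 < F ξ := hF.pos ξ hξ
  -- normalise the direction
  obtain ⟨η, hη, hFη, hgη⟩ : ∃ η, η ≠ 0 ∧ F η = c ∧ gradient F η = gradient F ξ := by
    have ht : 0 < c / F ξ := by positivity
    refine ⟨(c / F ξ) • ξ, smul_ne_zero ht.ne' hξ, ?_, hF.gradient_smul hξ ht⟩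
    rw [hF.homog, abs_of_pos ht]
    field_simp
  rw [← hgη] at hxy
  have hKc : Convex ℝ (closure Ω) := hconv.closure
  have hKi : closure Ω ⊆ closure (interior (closure Ω)) :=
    closure_mono (interior_maximal subset_closure hop)
  set ψ : ℝ → ℝ := fun s => (V₁ (W (κ * s)))⁻¹ * κ with hψ
  have hm : ∀ z ∈ closure Ω, W (κ * u z) ∈ Icc p q := fun z hz =>
    Ioo_subset_Icc_self (hW _ (hr z hz)).1
  have hψpos : ∀ z ∈ closure Ω, 0 < ψ (u z) := fun z hz =>
    mul_pos (inv_pos.2 (h.pos _ (hm z hz))) hκ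
  have hgw : ∀ z ∈ closure Ω, HasGradientWithinAt (fun x => W (κ * u x))
      (ψ (u z) • gradient u z) (closure Ω) z := fun z hz =>
    (hu.hasGradientWithinAt hF hne hop hconv hz).comp_hasDerivAt
      (hasDerivAt_inverse_mul hW (hr z hz))
  have hNu : ∀ z ∈ closure Ω, NeumannAt F (closure Ω) z (gradient u z) := fun z hz =>
    hu.neumannAt hop hz
  have hNw : ∀ z ∈ closure Ω, NeumannAt F (closure Ω) z (ψ (u z) • gradient u z) :=
    fun z hz => (hNu z hz).smul hF (hψpos z hz)
  have hθ : HasDerivAt (fun t : ℝ => t + δ * √t) (F η) d := hFη ▸ hasDerivAt_add_sqrt δ hd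
  have hgy : ψ (u y) • gradient u y = η :=
    hmod.gradient_eq hF hKc hKi hx hy hη hd hxy heq hθ (hgw y hy) (hNw y hy)
  have hgx : ψ (u x) • gradient u x = η := by
    have hyx : x = y + d • gradient F (-η) := by
      rw [hF.gradient_neg hη, hxy]; module
    have heq' : -W (κ * u x) - -W (κ * u y) = d + δ * √d := by linarith
    have hgn : HasGradientWithinAt (fun x => -W (κ * u x))
        (-(ψ (u x) • gradient u x)) (closure Ω) x := by
      have := hgw x hx
      rw [hasGradientWithinAt_iff_hasFDerivWithinAt] at this ⊢
      rw [map_neg]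
      exact this.neg
    have hθ' : HasDerivAt (fun t : ℝ => t + δ * √t) (F (-η)) d := by rwa [hF.even]
    have := (hmod.neg hF).gradient_eq hF hKc hKi hy hx (neg_ne_zero.2 hη) hd hyx heq' hθ' hgn
      ((hNw x hx).neg hF)
    exact neg_injective this
  have hgx0 : gradient u x ≠ 0 := fun h0 => hη (by rw [← hgx, h0, smul_zero])
  have hgy0 : gradient u y ≠ 0 := fun h0 => hη (by rw [← hgy, h0, smul_zero])
  -- the Hessian of the composition at the two ends
  have hHess : ∀ z ∈ closure Ω, ψ (u z) • gradient u z = η → gradient u z ≠ 0 →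
      ∃ H : EuclideanSpace ℝ (Fin n) →L[ℝ] EuclideanSpace ℝ (Fin n),
        HasFDerivWithinAt (fun z => ψ (u z) • gradient u z) H (closure Ω) z ∧
        ∑ i, ∑ j, aCoeff F i j η *
          ⟪H (EuclideanSpace.single j 1), EuclideanSpace.single i 1⟫ =
        -(lam * V (W (κ * u z)) / V₁ (W (κ * u z))) -
          c ^ 2 * (V₂ (W (κ * u z)) / V₁ (W (κ * u z))) := by
    intro z hz hgz hgz0
    obtain ⟨M, hM, hMe⟩ := hu.exists_hessian hF hne hop hconv hz hgz0
    refine ⟨_, HasFDerivWithinAt.comp_smul_gradient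
      (hu.hasGradientWithinAt hF hne hop hconv hz) hM
      (h.hasDerivAt_inverse_mul_deriv hW (hr z hz)), ?_⟩
    have hV := (hW _ (hr z hz)).2.1
    have hV₁ := h.pos _ (hm z hz)
    have hFg : ψ (u z) * F (gradient u z) = c := by
      rw [← hFη, ← hgz, hF.homog, abs_of_pos (hψpos z hz)]
    rw [← hgz, hF.sum_aCoeff_add_rank_one hgz0 (hψpos z hz), hMe, ← hFg, hV]
    simp only [hψ]
    field_simp
    ring
  obtain ⟨Hx, hHx, hAx⟩ := hHess x hx hgx hgx0
  obtain ⟨Hy, hHy, hAy⟩ := hHess y hy hgy hgy0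
  have hgrad : ∀ z ∈ closure Ω, ψ (u z) • gradient u z = η → gradient F (gradient u z) =
      gradient F η := by
    intro z hz hgz
    have : gradient u z ≠ 0 := fun h0 => hη (by rw [← hgz, h0, smul_zero])
    rw [← hgz, hF.gradient_smul this (hψpos z hz)]
  obtain ⟨ν, hν, hin⟩ := exists_common_inward hop hconv hsb hx hy hxy
    (fun ν hν hν' => by rw [← hgrad x hx hgx]; exact hNu x hx hgx0 ν hν hν')
    (fun ν hν hν' => by rw [← hgrad y hy hgy]; exact hNu y hy hgy0 ν hν hν')
  have hs1 := hm x hx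
  have hs2 := hm y hy
  set s₁ := W (κ * u x) with hs₁
  set s₂ := W (κ * u y) with hs₂
  have hmain := hmod.sum_aCoeff_le hF hKc hgw hx hy hη hd hxy heq hgx hgy hHx hHy
    (θ₂ := -δ / (4 * √d ^ 3)) (fun r₁ => by
      have := taylor_two_add_sqrt δ hd r₁
      rw [hFη]; exact this) hν hin (h.weight_pos s₁ hs1).le (h.weight_pos s₂ hs2).le
  rw [hAx, hAy, hFη] at hmain
  have hle : s₁ ≤ s₂ := by
    have : 0 < d + δ * √d := by positivity
    linarith
  exact absurd hδ₀ (not_lt.2 (h.contact_le hs1 hs2 hle heq hδ hd hK₀ hk₀ hmain))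

end IsStrictBarrier

end Contact

section Continuity

variable {n : ℕ} {F : EuclideanSpace ℝ (Fin n) → ℝ} {K : Set (EuclideanSpace ℝ (Fin n))}

theorem IsStronglyConvexMinkowskiNormC3.continuousOn_gradient
    (hF : IsStronglyConvexMinkowskiNormC3 F) : ContinuousOn (gradient F) {0}ᶜ :=
  fun _ hξ => (hF.contDiffAt_gradient hξ).continuousAt.continuousWithinAt

theorem IsStronglyConvexMinkowskiNormC3.exists_norm_eq_one
    (hF : IsStronglyConvexMinkowskiNormC3 F) {ξ : EuclideanSpace ℝ (Fin n)} (hξ : ξ ≠ 0) :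
    ∃ η : EuclideanSpace ℝ (Fin n), ‖η‖ = 1 ∧ gradient F η = gradient F ξ := by
  have h : 0 < ‖ξ‖ := norm_pos_iff.2 hξ
  refine ⟨‖ξ‖⁻¹ • ξ, ?_, hF.gradient_smul hξ (inv_pos.2 h)⟩
  rw [norm_smul, norm_inv, norm_norm, inv_mul_cancel₀ h.ne']

theorem IsStronglyConvexMinkowskiNormC3.gradient_ne_zero
    (hF : IsStronglyConvexMinkowskiNormC3 F) {ξ : EuclideanSpace ℝ (Fin n)} (hξ : ξ ≠ 0) :
    gradient F ξ ≠ 0 := by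
  intro h
  have := hF.inner_gradient_self hξ
  rw [h, inner_zero_left] at this
  exact (hF.pos ξ hξ).ne this

theorem IsStronglyConvexMinkowskiNormC3.exists_gradient_bounds
    (hF : IsStronglyConvexMinkowskiNormC3 F) :
    ∃ C : ℝ, 0 < C ∧ ∀ ξ, ξ ≠ 0 → ‖gradient F ξ‖ ≤ C ∧ 1 ≤ C * ‖gradient F ξ‖ := by
  have hS : IsCompact (Metric.sphere (0 : EuclideanSpace ℝ (Fin n)) 1) := isCompact_sphere 0 1
  have hS0 : Metric.sphere (0 : EuclideanSpace ℝ (Fin n)) 1 ⊆ {0}ᶜ := fun ξ hξ => by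
    rw [mem_sphere_zero_iff_norm] at hξ
    exact norm_ne_zero_iff.1 (by rw [hξ]; exact one_ne_zero)
  have hc := hF.continuousOn_gradient.mono hS0
  obtain ⟨C₁, hC₁⟩ := hS.exists_bound_of_continuousOn hc
  obtain ⟨C₂, hC₂⟩ := hS.exists_bound_of_continuousOn
    (hc.norm.inv₀ fun ξ hξ => norm_ne_zero_iff.2 (hF.gradient_ne_zero (hS0 hξ)))
  refine ⟨max 1 (max C₁ C₂), by positivity, fun ξ hξ => ?_⟩
  obtain ⟨η, hη, hηξ⟩ := hF.exists_norm_eq_one hξ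
  have hηS : η ∈ Metric.sphere (0 : EuclideanSpace ℝ (Fin n)) 1 := by simpa using hη
  have h1 := hC₁ η hηS
  have h2 := hC₂ η hηS
  have h3 : 0 < ‖gradient F ξ‖ := norm_pos_iff.2 (hF.gradient_ne_zero hξ)
  rw [Pi.inv_apply] at h2
  rw [hηξ] at h1 h2
  refine ⟨h1.trans ((le_max_left _ _).trans (le_max_right _ _)), ?_⟩
  rw [norm_inv, norm_norm] at h2
  rw [← div_le_iff₀ h3, one_div]
  exact h2.trans ((le_max_right _ _).trans (le_max_right _ _))

/-- The dual distance is bounded on bounded sets. -/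
theorem IsStronglyConvexMinkowskiNormC3.exists_dist_bound
    (hF : IsStronglyConvexMinkowskiNormC3 F) (hK : Bornology.IsBounded K) :
    ∃ R : ℝ, 0 < R ∧ ∀ x ∈ K, ∀ ξ, ξ ≠ 0 → ∀ r, 0 < r → x + r • gradient F ξ ∈ K → r ≤ R := by
  obtain ⟨C, hC, hCF⟩ := hF.exists_gradient_bounds
  obtain ⟨D, hD⟩ := hK.exists_norm_le
  refine ⟨C * (2 * |D|) + 1, by positivity, fun x hx ξ hξ r hr hy => ?_⟩
  have h1 : ‖r • gradient F ξ‖ ≤ 2 * |D| := by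
    have := norm_sub_le (x + r • gradient F ξ) x
    rw [add_sub_cancel_left] at this
    have := hD _ hy
    have := hD _ hx
    have := le_abs_self D
    linarith
  rw [norm_smul, Real.norm_eq_abs, abs_of_pos hr] at h1
  have h2 := (hCF ξ hξ).2
  nlinarith

/-- A continuity argument in the parameter `κ`: a modulus that is never touched is preserved. -/
theorem isDualModulus_of_not_contact (hF : IsStronglyConvexMinkowskiNormC3 F) (hK : IsCompact K)
    {w : ℝ → EuclideanSpace ℝ (Fin n) → ℝ} {κ₀ δ L : ℝ} (hκ₀ : 0 ≤ κ₀) (hδ : 0 < δ)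
    (hw : ContinuousOn (fun z : ℝ × EuclideanSpace ℝ (Fin n) => w z.1 z.2) (Icc 0 κ₀ ×ˢ K))
    (hL : ∀ κ ∈ Icc 0 κ₀, ∀ x ∈ K, ∀ y ∈ K, w κ y - w κ x ≤ L * ‖y - x‖)
    (h0 : ∀ x ∈ K, ∀ y ∈ K, w 0 y = w 0 x)
    (hcontact : ∀ κ ∈ Ioc 0 κ₀, IsDualModulus F K (w κ) (fun t => t + δ * √t) →
      ∀ x ∈ K, ∀ ξ, ξ ≠ 0 → ∀ r, 0 < r → x + r • gradient F ξ ∈ K →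
        w κ (x + r • gradient F ξ) - w κ x ≠ r + δ * √r) :
    IsDualModulus F K (w κ₀) (fun t => t + δ * √t) := by
  obtain ⟨R, hR, hRK⟩ := hF.exists_dist_bound hK.isBounded
  obtain ⟨C, hC, hCF⟩ := hF.exists_gradient_bounds
  set r₀ : ℝ := (δ / (|L| * C + 1)) ^ 2 with hr₀
  have hr₀pos : 0 < r₀ := by positivity
  have hviol : ∀ κ ∈ Icc 0 κ₀, ∀ x ∈ K, ∀ ξ, ξ ≠ 0 → ∀ r, 0 < r → x + r • gradient F ξ ∈ K →
      r + δ * √r ≤ w κ (x + r • gradient F ξ) - w κ x → r₀ ≤ r := by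
    intro κ hκ x hx ξ hξ r hr hy hle
    have h1 := hL κ hκ x hx _ hy
    rw [add_sub_cancel_left, norm_smul, Real.norm_eq_abs, abs_of_pos hr] at h1
    have h2 : L * (r * ‖gradient F ξ‖) ≤ |L| * (r * C) := by
      have := (hCF ξ hξ).1
      gcongr
      exact le_abs_self L
    have hs : 0 < √r := Real.sqrt_pos.2 hr
    have hsr : √r * √r = r := Real.mul_self_sqrt hr.le
    have h3 : δ ≤ √r * (|L| * C + 1) := by
      refine le_of_mul_le_mul_right ?_ hs
      have : √r * (|L| * C + 1) * √r = (√r * √r) * (|L| * C + 1) := by ring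
      rw [this, hsr]
      nlinarith
    rw [hr₀, ← Real.sq_sqrt hr.le]
    have := (div_le_iff₀ (by positivity : 0 < |L| * C + 1)).2 h3
    gcongr
  set S : Set (ℝ × EuclideanSpace ℝ (Fin n) × EuclideanSpace ℝ (Fin n) × ℝ) :=
    Icc 0 κ₀ ×ˢ K ×ˢ Metric.sphere 0 1 ×ˢ Icc r₀ R with hS
  have hSc : IsCompact S :=
    isCompact_Icc.prod (hK.prod ((isCompact_sphere 0 1).prod isCompact_Icc))
  have hmap : ContinuousOn (fun z : ℝ × EuclideanSpace ℝ (Fin n) × EuclideanSpace ℝ (Fin n) × ℝ =>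
      z.2.1 + z.2.2.2 • gradient F z.2.2.1) S := by
    have hg : ContinuousOn (fun z : ℝ × EuclideanSpace ℝ (Fin n) × EuclideanSpace ℝ (Fin n) × ℝ =>
        gradient F z.2.2.1) S := by
      refine hF.continuousOn_gradient.comp
        (f := fun z : ℝ × EuclideanSpace ℝ (Fin n) × EuclideanSpace ℝ (Fin n) × ℝ => z.2.2.1)
        (by fun_prop) fun z hz => ?_
      have := hz.2.2.1
      rw [mem_sphere_zero_iff_norm] at this
      exact norm_ne_zero_iff.1 (by rw [this]; exact one_ne_zero)
    fun_prop
  set S' := S ∩ (fun z : ℝ × EuclideanSpace ℝ (Fin n) × EuclideanSpace ℝ (Fin n) × ℝ =>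
      z.2.1 + z.2.2.2 • gradient F z.2.2.1) ⁻¹' K with hS'
  have hS'cl : IsClosed S' := hmap.preimage_isClosed_of_isClosed hSc.isClosed hK.isClosed
  have hΦ : ContinuousOn (fun z : ℝ × EuclideanSpace ℝ (Fin n) × EuclideanSpace ℝ (Fin n) × ℝ =>
      w z.1 (z.2.1 + z.2.2.2 • gradient F z.2.2.1) - w z.1 z.2.1 -
        (z.2.2.2 + δ * √z.2.2.2)) S' := by
    refine ContinuousOn.sub (ContinuousOn.sub ?_ ?_) (by fun_prop)
    · exact hw.comp (f := fun z : ℝ × EuclideanSpace ℝ (Fin n) × EuclideanSpace ℝ (Fin n) × ℝ =>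
        (z.1, z.2.1 + z.2.2.2 • gradient F z.2.2.1))
        (continuousOn_fst.prodMk (hmap.mono inter_subset_left)) fun z hz => ⟨hz.1.1, hz.2⟩
    · exact hw.comp (f := fun z : ℝ × EuclideanSpace ℝ (Fin n) × EuclideanSpace ℝ (Fin n) × ℝ =>
        (z.1, z.2.1)) (by fun_prop) fun z hz => ⟨hz.1.1, hz.1.2.1⟩
  set Z := S' ∩ (fun z : ℝ × EuclideanSpace ℝ (Fin n) × EuclideanSpace ℝ (Fin n) × ℝ =>
      w z.1 (z.2.1 + z.2.2.2 • gradient F z.2.2.1) - w z.1 z.2.1 -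
        (z.2.2.2 + δ * √z.2.2.2)) ⁻¹' Ici 0 with hZ
  have hZc : IsCompact Z := hSc.of_isClosed_subset
    (hΦ.preimage_isClosed_of_isClosed hS'cl isClosed_Ici)
    (inter_subset_left.trans inter_subset_left)
  have hmemZ : ∀ κ ∈ Icc 0 κ₀, ∀ x ∈ K, ∀ ξ, ξ ≠ 0 → ∀ r, 0 < r → x + r • gradient F ξ ∈ K →
      r + δ * √r ≤ w κ (x + r • gradient F ξ) - w κ x → ∃ η, (κ, x, η, r) ∈ Z := by
    intro κ hκ x hx ξ hξ r hr hy hle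
    obtain ⟨η, hη, hηξ⟩ := hF.exists_norm_eq_one hξ
    refine ⟨η, ⟨⟨hκ, hx, by simpa using hη, hviol κ hκ x hx ξ hξ r hr hy hle,
      hRK x hx ξ hξ r hr hy⟩, ?_⟩, ?_⟩
    · simpa only [mem_preimage, hηξ] using hy
    · simpa only [mem_preimage, hηξ, mem_Ici, sub_nonneg] using hle
  intro x hx ξ hξ r hr hy
  by_contra! hlt
  obtain ⟨η, hη⟩ := hmemZ κ₀ ⟨hκ₀, le_rfl⟩ x hx ξ hξ r hr hy hlt.le
  obtain ⟨⟨κ, x', ξ', r'⟩, hz, hmin⟩ := hZc.exists_isMinOn ⟨_, hη⟩ continuousOn_fst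
  obtain ⟨⟨⟨hκ, hx', hξ', hr'⟩, hy'⟩, hge⟩ := hz
  simp only at hκ hx' hξ' hr'
  simp only [mem_preimage, mem_Ici, sub_nonneg] at hge hy'
  have hr'pos : 0 < r' := hr₀pos.trans_le hr'.1
  have hξ'0 : ξ' ≠ 0 := by
    rw [mem_sphere_zero_iff_norm] at hξ'
    exact norm_ne_zero_iff.1 (by rw [hξ']; exact one_ne_zero)
  have hκpos : 0 < κ := by
    refine lt_of_le_of_ne hκ.1 fun h => ?_
    rw [← h, h0 x' hx' _ hy', sub_self] at hge
    have : 0 < r' + δ * √r' := by positivity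
    linarith
  have hmod : IsDualModulus F K (w κ) (fun t => t + δ * √t) := by
    intro x₁ hx₁ ξ₁ hξ₁ r₁ hr₁ hy₁
    have hlim : ∀ z ∈ K, Tendsto (fun κ' => w κ' z) (𝓝[<] κ) (𝓝 (w κ z)) := by
      intro z hz
      have h1 : Tendsto (fun κ' => (κ', z)) (𝓝[<] κ) (𝓝[Icc 0 κ₀ ×ˢ K] (κ, z)) := by
        refine tendsto_nhdsWithin_iff.2 ⟨?_, ?_⟩
        · exact ((continuous_id.prodMk continuous_const).tendsto κ).mono_left nhdsWithin_le_nhds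
        · filter_upwards [Ioo_mem_nhdsLT hκpos] with κ' hκ'
          exact ⟨⟨hκ'.1.le, hκ'.2.le.trans hκ.2⟩, hz⟩
      exact (hw (κ, z) ⟨hκ, hz⟩).tendsto.comp h1
    refine le_of_tendsto ((hlim _ hy₁).sub (hlim _ hx₁)) ?_
    filter_upwards [Ioo_mem_nhdsLT hκpos] with κ' hκ'
    by_contra! hgt
    obtain ⟨η₁, hη₁⟩ := hmemZ κ' ⟨hκ'.1.le, hκ'.2.le.trans hκ.2⟩ x₁ hx₁ ξ₁ hξ₁ r₁ hr₁ hy₁ hgt.le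
    exact absurd (hmin hη₁) (not_le.2 hκ'.2)
  refine hcontact κ ⟨hκpos, hκ.2⟩ hmod x' hx' ξ' hξ'0 r' hr'pos hy' (le_antisymm ?_ hge)
  exact hmod x' hx' ξ' hξ'0 r' hr'pos hy'

end Continuity

section Comparison

variable {n : ℕ} {lam p q m ε₀ : ℝ} {V V₁ V₂ ω : ℝ → ℝ}
  {F u : EuclideanSpace ℝ (Fin n) → ℝ} {Ω : Set (EuclideanSpace ℝ (Fin n))}

namespace IsStrictBarrier

theorem continuousOn (h : IsStrictBarrier n lam V V₁ V₂ ω p q m ε₀) :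
    ContinuousOn V (Icc p q) := fun t ht => (h.hasDerivAt t ht).continuousAt.continuousWithinAt

theorem continuousOn₁ (h : IsStrictBarrier n lam V V₁ V₂ ω p q m ε₀) :
    ContinuousOn V₁ (Icc p q) := fun t ht => (h.hasDerivAt₁ t ht).continuousAt.continuousWithinAt

theorem exists_constants (h : IsStrictBarrier n lam V V₁ V₂ ω p q m ε₀) :
    ∃ K₀ k₀ B : ℝ, 0 ≤ K₀ ∧ 0 < k₀ ∧ (∀ t ∈ Icc p q, |ω t ^ 2 * (lam * V t / V₁ t)| ≤ K₀) ∧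
      (∀ s ∈ Icc p q, ∀ t ∈ Icc p q, k₀ ≤ (ω s + ω t) ^ 2) ∧
      ∀ t ∈ Icc p q, (V₁ t)⁻¹ ≤ B := by
  have hp : p ∈ Icc p q := ⟨le_rfl, h.lt.le⟩
  have hV₁ : ∀ t ∈ Icc p q, V₁ t ≠ 0 := fun t ht => (h.pos t ht).ne'
  have hc : ContinuousOn (fun t => ω t ^ 2 * (lam * V t / V₁ t)) (Icc p q) :=
    (h.weight_cont.pow 2).mul ((h.continuousOn.const_mul lam).div h.continuousOn₁ hV₁)
  obtain ⟨K₀, hK₀⟩ := isCompact_Icc.exists_bound_of_continuousOn hc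
  obtain ⟨B, hB⟩ := isCompact_Icc.exists_bound_of_continuousOn (h.continuousOn₁.inv₀ hV₁)
  obtain ⟨t₀, ht₀, hmin⟩ := isCompact_Icc.exists_isMinOn ⟨p, hp⟩ h.weight_cont
  refine ⟨K₀, (2 * ω t₀) ^ 2, B, (norm_nonneg _).trans (hK₀ p hp), ?_, hK₀, ?_,
    fun t ht => (le_abs_self _).trans (hB t ht)⟩
  · have := h.weight_pos t₀ ht₀
    positivity
  · intro s hs t ht
    have h0 := h.weight_pos t₀ ht₀
    have h1 : ω t₀ ≤ ω s := hmin hs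
    have h2 : ω t₀ ≤ ω t := hmin ht
    gcongr
    linarith

/-- The gradient estimate obtained from a strict barrier. -/
theorem gradient_le (h : IsStrictBarrier n lam V V₁ V₂ ω p q m ε₀)
    (hne : Ω.Nonempty) (hbd : Bornology.IsBounded Ω) (hop : IsOpen Ω) (hconv : Convex ℝ Ω)
    (hsb : HasSmoothBoundary Ω)
    (hF : IsStronglyConvexMinkowskiNormC3 F) (hu : IsNeumannEigenfunction F Ω lam u)
    {κ₀ : ℝ} (hκ₀ : 0 < κ₀) (h0 : 0 ∈ Ioo (V p) (V q))
    (hr : ∀ x ∈ closure Ω, κ₀ * u x ∈ Ioo (V p) (V q)) {x : EuclideanSpace ℝ (Fin n)}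
    (hx : x ∈ closure Ω) :
    ∃ s ∈ Ioo p q, V s = κ₀ * u x ∧ κ₀ * F (gradient u x) ≤ V₁ s := by
  obtain ⟨W, hW⟩ := h.exists_inverse
  obtain ⟨K₀, k₀, B, hK₀, hk₀, hK₀', hk₀', hB⟩ := h.exists_constants
  have hK : IsCompact (closure Ω) := hbd.isCompact_closure
  obtain ⟨R, hR, hRK⟩ := hF.exists_dist_bound hK.isBounded
  obtain ⟨δ₀, hδ₀, hδ₀'⟩ := exists_strict_modulus hK₀ hk₀ h.m_nonneg h.gap_pos
    (Real.sqrt_pos.2 hR)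
  have hrκ : ∀ κ ∈ Icc 0 κ₀, ∀ x ∈ closure Ω, κ * u x ∈ Ioo (V p) (V q) := by
    intro κ hκ x hx
    obtain ⟨h1, h2⟩ := hr x hx
    rcases le_total 0 (u x) with hux | hux
    · exact ⟨h0.1.trans_le (mul_nonneg hκ.1 hux),
        (mul_le_mul_of_nonneg_right hκ.2 hux).trans_lt h2⟩
    · exact ⟨h1.trans_le (mul_le_mul_of_nonpos_right hκ.2 hux),
        (mul_nonpos_of_nonneg_of_nonpos hκ.1 hux).trans_lt h0.2⟩
  have hgu := fun z (hz : z ∈ closure Ω) => hu.hasGradientWithinAt hF hne hop hconv hz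
  have huc : ContinuousOn u (closure Ω) := hu.contDiff1.continuousOn
  have hguc := hu.continuousOn_gradient hF hne hop hconv
  have hWc : ContinuousOn W (Ioo (V p) (V q)) := fun s hs =>
    (hW s hs).2.2.continuousAt.continuousWithinAt
  have hgw : ∀ κ ∈ Icc 0 κ₀, ∀ z ∈ closure Ω, HasGradientWithinAt (fun x => W (κ * u x))
      (((V₁ (W (κ * u z)))⁻¹ * κ) • gradient u z) (closure Ω) z := fun κ hκ z hz =>
    (hgu z hz).comp_hasDerivAt (hasDerivAt_inverse_mul hW (hrκ κ hκ z hz))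
  obtain ⟨G, hG⟩ := hK.exists_bound_of_continuousOn hguc
  have hmod : ∀ δ, 0 < δ → δ ≤ δ₀ →
      IsDualModulus F (closure Ω) (fun x => W (κ₀ * u x)) (fun t => t + δ * √t) := by
    intro δ hδ hδle
    refine isDualModulus_of_not_contact (w := fun κ x => W (κ * u x)) (L := B * κ₀ * G) hF hK
      hκ₀.le hδ ?_ ?_ ?_ ?_
    · refine hWc.comp (f := fun z : ℝ × EuclideanSpace ℝ (Fin n) => z.1 * u z.2) ?_
        fun z hz => hrκ z.1 hz.1 z.2 hz.2
      exact continuousOn_fst.mul (huc.comp continuousOn_snd fun z hz => hz.2)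
    · intro κ hκ x hx y hy
      refine (le_abs_self _).trans ?_
      refine hconv.closure.norm_image_sub_le_of_norm_hasFDerivWithin_le
        (fun z hz => hasGradientWithinAt_iff_hasFDerivWithinAt.1 (hgw κ hκ z hz))
        (fun z hz => ?_) hx hy
      have hm := Ioo_subset_Icc_self (hW _ (hrκ κ hκ z hz)).1
      have h1 := hB _ hm
      have h2 : 0 < (V₁ (W (κ * u z)))⁻¹ := inv_pos.2 (h.pos _ hm)
      rw [LinearIsometryEquiv.norm_map, norm_smul, Real.norm_eq_abs,
        abs_of_nonneg (mul_nonneg h2.le hκ.1)]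
      have hB0 : 0 ≤ B := h2.le.trans h1
      have := hG z hz
      have := hκ.2
      have := hκ.1
      gcongr
    · intro x _ y _
      simp
    · intro κ hκ hmodκ x hx ξ hξ r hrr hy heq
      have hsr : √r ≤ √R := Real.sqrt_le_sqrt (hRK x hx ξ hξ r hrr hy)
      have hstrict := hδ₀' δ hδ hδle (√r) (Real.sqrt_pos.2 hrr) hsr
      rw [Real.sq_sqrt hrr.le] at hstrict
      exact h.not_contact hW hne hop hconv hsb hF hu hκ.1 (hrκ κ ⟨hκ.1.le, hκ.2⟩) hδ hrr hK₀' hk₀'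
        hstrict hmodκ hx hy hξ rfl heq
  have hlim : IsDualModulus F (closure Ω) (fun x => W (κ₀ * u x)) (fun t => t) := by
    intro x hx ξ hξ r hrr hy
    have h1 : Tendsto (fun δ : ℝ => r + δ * √r) (𝓝[>] 0) (𝓝 r) := by
      have : Tendsto (fun δ : ℝ => r + δ * √r) (𝓝 0) (𝓝 (r + 0 * √r)) :=
        Continuous.tendsto (by fun_prop) 0
      rw [zero_mul, add_zero] at this
      exact this.mono_left nhdsWithin_le_nhds
    refine ge_of_tendsto h1 ?_
    filter_upwards [Ioc_mem_nhdsGT hδ₀] with δ hδ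
    exact hmod δ hδ.1 hδ.2 x hx ξ hξ r hrr hy
  have hκm : κ₀ ∈ Icc 0 κ₀ := ⟨hκ₀.le, le_rfl⟩
  have hm : ∀ z ∈ closure Ω, W (κ₀ * u z) ∈ Icc p q := fun z hz =>
    Ioo_subset_Icc_self (hW _ (hr z hz)).1
  have hΩ : ∀ z ∈ Ω, κ₀ * F (gradient u z) ≤ V₁ (W (κ₀ * u z)) := by
    intro z hz
    have hz' := subset_closure hz
    have hV := h.pos _ (hm z hz')
    by_cases hg : gradient u z = 0
    · rw [hg, hF.map_zero, mul_zero]; exact hV.le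
    have hev : ∀ᶠ τ in 𝓝[>] (0 : ℝ), z + τ • gradient F (gradient u z) ∈ closure Ω :=
      (HasVelocity.line z _).tendsto.eventually_mem
        (mem_of_superset (hop.mem_nhds hz) subset_closure)
    have hvel := (HasVelocity.line z (gradient F (gradient u z))).comp_hasFDerivWithinAt hev
      (hasGradientWithinAt_iff_hasFDerivWithinAt.1 (hgw κ₀ hκm z hz'))
    have hle := nonpos_of_isLittleO_id
      (e := fun τ => W (κ₀ * u (z + τ • gradient F (gradient u z))) - W (κ₀ * u z) - τ)
      (A := (V₁ (W (κ₀ * u z)))⁻¹ * κ₀ * F (gradient u z) - 1) (by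
        refine IsLittleO.congr_left hvel fun τ => ?_
        rw [InnerProductSpace.toDual_apply_apply, inner_smul_left, real_inner_comm,
          hF.inner_gradient_self hg]
        simp only [conj_trivial, smul_eq_mul]
        ring) (by
        filter_upwards [hev, self_mem_nhdsWithin] with τ hτ hτ0
        have := hlim z hz' (gradient u z) hg τ hτ0 hτ
        simp only at this
        linarith)
    have h2 : (V₁ (W (κ₀ * u z)))⁻¹ * κ₀ * F (gradient u z) =
      κ₀ * F (gradient u z) / V₁ (W (κ₀ * u z)) := by ring
    rw [h2, sub_nonpos, div_le_one hV] at hle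
    exact hle
  refine ⟨W (κ₀ * u x), (hW _ (hr x hx)).1, (hW _ (hr x hx)).2.1, ?_⟩
  refine le_on_closure hΩ ?_ ?_ hx
  · exact (hF.continuous.comp_continuousOn hguc).const_mul κ₀
  · refine h.continuousOn₁.comp (hWc.comp (huc.const_mul κ₀) hr) hm

end IsStrictBarrier

end Comparison

section Barrier

theorem exists_pos_add_mul_pos {p q : ℝ} {a b : ℝ → ℝ} (hpq : p ≤ q)
    (ha : ContinuousOn a (Icc p q)) (hb : ContinuousOn b (Icc p q))
    (hpos : ∀ t ∈ Icc p q, 0 < a t) :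
    ∃ ε₁ > 0, ∀ ε, 0 < ε → ε ≤ ε₁ → ∀ t ∈ Icc p q, 0 < a t + ε * b t := by
  obtain ⟨t₀, ht₀, hmin⟩ := isCompact_Icc.exists_isMinOn ⟨p, ⟨le_rfl, hpq⟩⟩ ha
  obtain ⟨B, hB⟩ := isCompact_Icc.exists_bound_of_continuousOn hb
  have h0 := hpos t₀ ht₀
  refine ⟨a t₀ / (2 * (|B| + 1)), by positivity, fun ε hε hle t ht => ?_⟩
  rw [le_div_iff₀ (by positivity)] at hle
  have h1 : a t₀ ≤ a t := hmin ht
  have h2 := (abs_le.1 (hB t ht)).1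
  have h3 : -|B| ≤ b t := (neg_le_neg (le_abs_self B)).trans h2
  have h4 : ε * -|B| ≤ ε * b t := mul_le_mul_of_nonneg_left h3 hε.le
  nlinarith

/-- Perturbing a solution of the model equation gives strict barriers. -/
theorem exists_strictBarrier {n i : ℕ} {lam p q m N : ℝ} {v v₁ v₂ T : ℝ → ℝ} (hpq : p < q)
    (hlam : 0 < lam) (hN : 0 < N) (hm : 0 ≤ m)
    (hv : ∀ t ∈ Icc p q, HasDerivAt v (v₁ t) t)
    (hv₁ : ∀ t ∈ Icc p q, HasDerivAt v₁ (v₂ t) t) (hpos : ∀ t ∈ Icc p q, 0 < v₁ t)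
    (hT : ContinuousOn T (Icc p q)) (hode : ∀ t ∈ Icc p q, v₂ t = T t * v₁ t - lam * v t)
    (hTN : ∀ t ∈ Icc p q, t * T t = -(N - 1))
    (hω : ∀ t ∈ Icc p q, 0 < t ^ i)
    (hωT : ∀ t ∈ Icc p q, (t ^ i) ^ 2 * T t = -(m * t))
    (hsub : ∀ s ∈ Icc p q, ∀ t ∈ Icc p q,
      ((n : ℝ) - 1) * (t ^ i - s ^ i) ^ 2 ≤ m * (t - s) ^ 2) :
    ∃ h k : ℝ → ℝ, ContinuousOn h (Icc p q) ∧ ContinuousOn k (Icc p q) ∧ ∃ ε₁ > 0, ∀ ε, 0 < ε →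
      ε ≤ ε₁ → ∃ (V₂ : ℝ → ℝ) (ε₀ : ℝ), IsStrictBarrier n lam (fun s => v s + ε * h s)
        (fun s => v₁ s + ε * k s) V₂ (fun s => s ^ i) p q m ε₀ := by
  have hvc : ContinuousOn v (Icc p q) := fun t ht => (hv t ht).continuousAt.continuousWithinAt
  have hv₁c : ContinuousOn v₁ (Icc p q) := fun t ht => (hv₁ t ht).continuousAt.continuousWithinAt
  have hv₂c : ContinuousOn v₂ (Icc p q) :=
    ((hT.mul hv₁c).sub (hvc.const_mul lam)).congr hode
  set c : ℝ := N⁻¹ with hc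
  have hNc : N * c = 1 := mul_inv_cancel₀ hN.ne'
  set h : ℝ → ℝ := fun s => -(s * v₁ s + lam * c * (s ^ 2 * v s)) with hh
  set k : ℝ → ℝ := fun s =>
    -((2 - N) * v₁ s + lam * (2 * c - 1) * (s * v s) + lam * c * (s ^ 2 * v₁ s)) with hk
  set l : ℝ → ℝ := fun s => -((2 - N) * v₂ s + lam * (2 * c - 1) * (v s + s * v₁ s) +
    lam * c * (2 * s * v₁ s + s ^ 2 * v₂ s)) with hl
  have hhc : ContinuousOn h (Icc p q) := by fun_prop
  have hkc : ContinuousOn k (Icc p q) := by fun_prop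
  have hlc : ContinuousOn l (Icc p q) := by fun_prop
  have hhd : ∀ t ∈ Icc p q, HasDerivAt h (k t) t := by
    intro t ht
    have h1 := (((hasDerivAt_id t).mul (hv₁ t ht)).add
      ((((hasDerivAt_pow 2 t).mul (hv t ht))).const_mul (lam * c))).neg
    refine h1.congr_deriv ?_
    simp only [id, hk, hode t ht]
    push_cast
    linear_combination -v₁ t * hTN t ht
  have hkd : ∀ t ∈ Icc p q, HasDerivAt k (l t) t := by
    intro t ht
    have h1 := ((((hv₁ t ht).const_mul (2 - N)).add
      (((hasDerivAt_id t).mul (hv t ht)).const_mul (lam * (2 * c - 1)))).add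
      ((((hasDerivAt_pow 2 t).mul (hv₁ t ht))).const_mul (lam * c))).neg
    refine h1.congr_deriv ?_
    simp only [id, hl]
    push_cast
    ring
  refine ⟨h, k, hhc, hkc, ?_⟩
  obtain ⟨e₁, he₁, hV₁⟩ := exists_pos_add_mul_pos hpq.le hv₁c hkc hpos
  obtain ⟨e₂, he₂, hB⟩ := exists_pos_add_mul_pos (a := fun s => (2 * i + 1) * v₁ s ^ 2)
    (b := fun s => (2 * i + 1) * v₁ s * k s + s * (v₂ s * k s - v₁ s * l s)) hpq.le
    (by fun_prop) (by fun_prop) (fun t ht => by have := hpos t ht; positivity)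
  refine ⟨min e₁ e₂, lt_min he₁ he₂, fun ε hε hle => ?_⟩
  have hV₁' := hV₁ ε hε (hle.trans (min_le_left _ _))
  have hB' := hB ε hε (hle.trans (min_le_right _ _))
  set V₁ : ℝ → ℝ := fun s => v₁ s + ε * k s with hV₁def
  have hV₁d : ∀ t ∈ Icc p q, HasDerivAt V₁ (v₂ t + ε * l t) t := fun t ht =>
    (hv₁ t ht).add ((hkd t ht).const_mul ε)
  have hV₁c : ContinuousOn V₁ (Icc p q) := by fun_prop
  set f : ℝ → ℝ := fun s => s ^ (2 * i + 1) * v₁ s / V₁ s with hf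
  set f' : ℝ → ℝ := fun s => s ^ (2 * i) * ((2 * i + 1) * v₁ s ^ 2 +
    ε * ((2 * i + 1) * v₁ s * k s + s * (v₂ s * k s - v₁ s * l s))) / V₁ s ^ 2 with hf'
  have hfd : ∀ t ∈ Icc p q, HasDerivAt f (f' t) t := by
    intro t ht
    have h1 := ((hasDerivAt_pow (2 * i + 1) t).mul (hv₁ t ht)).div (hV₁d t ht) (hV₁' t ht).ne'
    refine h1.congr_deriv ?_
    simp only [hf', hV₁def, Pi.mul_apply]
    congr 1
    rw [Nat.add_sub_cancel]
    push_cast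
    ring
  have hf'c : ContinuousOn f' (Icc p q) := by
    refine ContinuousOn.div (by fun_prop) (by fun_prop) fun t ht => pow_ne_zero 2 (hV₁' t ht).ne'
  have hf'pos : ∀ t ∈ Icc p q, 0 < f' t := by
    intro t ht
    refine div_pos (mul_pos ?_ (hB' t ht)) (pow_pos (hV₁' t ht) 2)
    rw [mul_comm 2 i, pow_mul]
    exact pow_pos (hω t ht) 2
  obtain ⟨t₀, ht₀, hmin⟩ := isCompact_Icc.exists_isMinOn ⟨p, ⟨le_rfl, hpq.le⟩⟩ hf'c
  have hgrow : ∀ s ∈ Icc p q, ∀ t ∈ Icc p q, s ≤ t → f' t₀ * (t - s) ≤ f t - f s := by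
    refine Convex.mul_sub_le_image_sub_of_le_deriv (convex_Icc p q)
      (fun t ht => (hfd t ht).continuousAt.continuousWithinAt)
      (fun t ht => (hfd t (interior_subset ht)).differentiableAt.differentiableWithinAt)
      fun t ht => ?_
    rw [(hfd t (interior_subset ht)).deriv]
    exact hmin (interior_subset ht)
  have hP : ∀ t ∈ Icc p q, (t ^ i) ^ 2 * (-(lam * (v t + ε * h t) + (v₂ t + ε * l t)) / V₁ t) =
      m * t + ε * (4 * lam * c) * f t := by
    intro t ht
    have h1 : lam * (v t + ε * h t) + (v₂ t + ε * l t) =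
        T t * V₁ t - ε * (4 * lam * c) * (t * v₁ t) := by
      simp only [hh, hl, hV₁def, hk, hode t ht]
      linear_combination ε * lam * (2 * c - 1) * v t * hTN t ht - 2 * ε * lam * v t * hNc
    have h2 := (hV₁' t ht).ne'
    have h3 : V₁ t ≠ 0 := h2
    rw [h1]
    simp only [hf]
    have h4 : (t ^ i) ^ 2 * (-(T t * V₁ t - ε * (4 * lam * c) * (t * v₁ t)) / V₁ t) =
      -((t ^ i) ^ 2 * T t) + ε * (4 * lam * c) * ((t ^ i) ^ 2 * t * v₁ t / V₁ t) := by
      field_simp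
      ring
    rw [h4, hωT t ht, ← pow_mul, mul_comm i 2, ← pow_succ]
    ring
  refine ⟨fun t => v₂ t + ε * l t, ε * (4 * lam * c) * f' t₀, ?_⟩
  have hcpos : 0 < ε * (4 * lam * c) := by positivity
  exact
    { lt := hpq
      hasDerivAt := fun t ht => (hv t ht).add ((hhd t ht).const_mul ε)
      hasDerivAt₁ := hV₁d
      pos := hV₁'
      weight_cont := by fun_prop
      weight_pos := hω
      m_nonneg := hm
      gap_pos := mul_pos hcpos (hf'pos t₀ ht₀)
      weight_sub := hsub
      strict := fun s hs t ht hst => by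
        rw [hP t ht, hP s hs]
        have := mul_le_mul_of_nonneg_left (hgrow s hs t ht hst) hcpos.le
        linarith }

end Barrier

section Endpoint

variable {n : ℕ} {lam : ℝ} {F u : EuclideanSpace ℝ (Fin n) → ℝ}
  {Ω : Set (EuclideanSpace ℝ (Fin n))}

theorem IsNeumannEigenfunction.gradient_eq_zero_of_extremum
    (hF : IsStronglyConvexMinkowskiNormC3 F) (hu : IsNeumannEigenfunction F Ω lam u)
    (hne : Ω.Nonempty) (hop : IsOpen Ω) (hconv : Convex ℝ Ω) {x : EuclideanSpace ℝ (Fin n)}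
    (hx : x ∈ closure Ω) {σ : ℝ} (hσ : σ ≠ 0) (hmin : ∀ z ∈ closure Ω, σ * u x ≤ σ * u z) :
    gradient u x = 0 := by
  by_contra hG
  have hle : ∀ z ∈ closure Ω, ⟪(-σ) • gradient u x, z - x⟫ ≤ 0 := by
    intro z hz
    have hev : ∀ᶠ τ in 𝓝[>] (0 : ℝ), x + τ • (z - x) ∈ closure Ω := by
      filter_upwards [eventually_mem_Ioo_nhdsGT] with τ hτ
      exact hconv.closure.add_smul_sub_mem hx hz ⟨hτ.1.le, hτ.2.le⟩
    have hvel := (HasVelocity.line x (z - x)).comp_hasFDerivWithinAt hev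
      (hasGradientWithinAt_iff_hasFDerivWithinAt.1
        (hu.hasGradientWithinAt hF hne hop hconv hx))
    refine nonpos_of_isLittleO_id (e := fun τ => (-σ) * (u (x + τ • (z - x)) - u x)) ?_ ?_
    · refine (IsLittleO.const_mul_left hvel (-σ)).congr_left fun τ => ?_
      rw [InnerProductSpace.toDual_apply_apply, inner_smul_left]
      simp only [conj_trivial, smul_eq_mul]
      ring
    · filter_upwards [hev] with τ hτ
      have := hmin _ hτ
      linarith
  have h1 := hu.neumannAt hop hx hG _ (smul_ne_zero (neg_ne_zero.2 hσ) hG) hle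
  rw [inner_smul_right, hF.inner_gradient_self hG] at h1
  exact (mul_ne_zero (neg_ne_zero.2 hσ) (hF.pos _ hG).ne') h1

theorem not_nonneg_of_integral_eq_zero (hbd : Bornology.IsBounded Ω) (hop : IsOpen Ω)
    (huc : ContinuousOn u (closure Ω)) (hnc : ¬ ∃ c : ℝ, ∀ x ∈ closure Ω, u x = c)
    (hmean : ∫ x in Ω, u x = 0) : ¬ ∀ x ∈ closure Ω, 0 ≤ u x := by
  intro hnn
  have hint : MeasureTheory.IntegrableOn u Ω :=
    (huc.integrableOn_compact hbd.isCompact_closure).mono_set subset_closure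
  have hae : u =ᵐ[MeasureTheory.volume.restrict Ω] 0 := by
    refine (MeasureTheory.setIntegral_eq_zero_iff_of_nonneg_ae ?_ hint).1 hmean
    filter_upwards [MeasureTheory.ae_restrict_mem hop.measurableSet] with x hx
    exact hnn x (subset_closure hx)
  have heq : EqOn u 0 Ω := MeasureTheory.Measure.eqOn_open_of_ae_eq hae hop
    (huc.mono subset_closure) continuousOn_const
  exact hnc ⟨0, heq.of_subset_closure huc continuousOn_const subset_closure subset_rfl⟩

theorem exists_perturbation (hn : 1 ≤ n) (hlam : 0 < lam) {a b : ℝ} {T v : ℝ → ℝ}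
    (hT : ((∀ t : ℝ, T t = -((n : ℝ) - 1) / t) ∧ 0 < a) ∨ (∀ t : ℝ, T t = 0))
    (hv : ContDiffOn ℝ 2 v (Icc a b))
    (hode : ∀ t ∈ Ioo a b, deriv (deriv v) t - T t * deriv v t = -lam * v t)
    (hv' : ∀ t ∈ Ioo a b, 0 < deriv v t) {p q : ℝ} (hap : a < p) (hpq : p < q) (hqb : q < b) :
    ∃ (i : ℕ) (m : ℝ) (h k : ℝ → ℝ), ContinuousOn h (Icc p q) ∧ ContinuousOn k (Icc p q) ∧
      ∃ ε₁ > 0, ∀ ε, 0 < ε → ε ≤ ε₁ → ∃ (V₂ : ℝ → ℝ) (ε₀ : ℝ), IsStrictBarrier n lam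
        (fun s => v s + ε * h s) (fun s => deriv v s + ε * k s) V₂ (fun s => s ^ i) p q m ε₀ := by
  have hsub : Icc p q ⊆ Ioo a b := Icc_subset_Ioo hap hqb
  have hvo : ContDiffOn ℝ 2 v (Ioo a b) := hv.mono Ioo_subset_Icc_self
  have hd1 : ∀ t ∈ Icc p q, HasDerivAt v (deriv v t) t := fun t ht =>
    ((hvo.contDiffAt (isOpen_Ioo.mem_nhds (hsub ht))).differentiableAt two_ne_zero).hasDerivAt
  have hvo' : ContDiffOn ℝ 1 (deriv v) (Ioo a b) :=
    hvo.deriv_of_isOpen isOpen_Ioo (by norm_num)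
  have hd2 : ∀ t ∈ Icc p q, HasDerivAt (deriv v) (deriv (deriv v) t) t := fun t ht =>
    ((hvo'.contDiffAt (isOpen_Ioo.mem_nhds (hsub ht))).differentiableAt one_ne_zero).hasDerivAt
  have hpos : ∀ t ∈ Icc p q, 0 < deriv v t := fun t ht => hv' t (hsub ht)
  have hode' : ∀ t ∈ Icc p q, deriv (deriv v) t = T t * deriv v t - lam * v t := fun t ht => by
    have := hode t (hsub ht)
    linarith
  have hn' : (1 : ℝ) ≤ n := by exact_mod_cast hn
  rcases hT with ⟨hT, ha⟩ | hT
  · have h0 : ∀ t ∈ Icc p q, 0 < t := fun t ht => ha.trans (hsub ht).1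
    refine ⟨1, (n : ℝ) - 1, exists_strictBarrier (N := n) (T := T) hpq hlam (by linarith)
      (by linarith) hd1 hd2 hpos ?_ hode' ?_ ?_ ?_ ?_⟩
    · refine (ContinuousOn.div continuousOn_const continuousOn_id fun t ht => (h0 t ht).ne').congr
        fun t _ => hT t
    · intro t ht
      have := (h0 t ht).ne'
      rw [hT t]; field_simp
    · intro t ht; simpa using h0 t ht
    · intro t ht
      have := (h0 t ht).ne'
      rw [hT t]; field_simp
    · intro s _ t _
      simp
  · refine ⟨0, 0, exists_strictBarrier (N := 1) (T := T) hpq hlam one_pos le_rfl hd1 hd2 hpos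
      (continuousOn_const.congr fun t _ => hT t) hode' ?_ ?_ ?_ ?_⟩
    all_goals simp [hT]

end Endpoint

section Main

variable {n : ℕ} {lam : ℝ} {F u : EuclideanSpace ℝ (Fin n) → ℝ}
  {Ω : Set (EuclideanSpace ℝ (Fin n))}

theorem eventually_add_mul_lt {x y c : ℝ} (h : x < c) : ∀ᶠ ε in 𝓝[>] (0 : ℝ), x + ε * y < c := by
  have : Tendsto (fun ε : ℝ => x + ε * y) (𝓝 0) (𝓝 (x + 0 * y)) :=
    Continuous.tendsto (by fun_prop) 0
  rw [zero_mul, add_zero] at this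
  exact (this.mono_left nhdsWithin_le_nhds).eventually_lt_const h

theorem eventually_lt_add_mul {x y c : ℝ} (h : c < x) : ∀ᶠ ε in 𝓝[>] (0 : ℝ), c < x + ε * y := by
  filter_upwards [eventually_add_mul_lt (y := -y) (neg_lt_neg h)] with ε hε
  linarith

theorem gradient_comparison_interior (hn : 1 ≤ n) (hne : Ω.Nonempty)
    (hbd : Bornology.IsBounded Ω) (hop : IsOpen Ω) (hconv : Convex ℝ Ω)
    (hsb : HasSmoothBoundary Ω) (hF : IsStronglyConvexMinkowskiNormC3 F) (hlam : 0 < lam)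
    (hu : IsNeumannEigenfunction F Ω lam u) {a b : ℝ} (hab : a < b) {T v : ℝ → ℝ}
    (hT : ((∀ t : ℝ, T t = -((n : ℝ) - 1) / t) ∧ 0 < a) ∨ (∀ t : ℝ, T t = 0))
    (hv : ContDiffOn ℝ 2 v (Icc a b))
    (hode : ∀ t ∈ Ioo a b, deriv (deriv v) t - T t * deriv v t = -lam * v t)
    (hv' : ∀ t ∈ Ioo a b, 0 < deriv v t)
    (hrange : ∀ x ∈ closure Ω, v a ≤ u x ∧ u x ≤ v b) (hva0 : v a < 0) (hvb0 : 0 < v b)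
    {x : EuclideanSpace ℝ (Fin n)} (hx : x ∈ closure Ω) {t : ℝ} (ht : t ∈ Ioo a b)
    (hvt : v t = u x) : F (gradient u x) ≤ deriv v t := by
  by_contra! hlt
  obtain ⟨M, hM1, hM2⟩ := exists_between hlt
  have hvo : ContDiffOn ℝ 2 v (Ioo a b) := hv.mono Ioo_subset_Icc_self
  have hdc : ContinuousOn (deriv v) (Ioo a b) :=
    (hvo.deriv_of_isOpen (m := 1) isOpen_Ioo (by norm_num)).continuousOn
  have hmono : StrictMonoOn v (Icc a b) := by
    refine strictMonoOn_of_deriv_pos (convex_Icc a b) hv.continuousOn fun s hs => ?_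
    rw [interior_Icc] at hs
    exact hv' s hs
  -- a neighbourhood of `t` where `v' < M`
  obtain ⟨c, e, hte, hce⟩ : ∃ c e, t ∈ Ioo c e ∧ ∀ s ∈ Icc c e, s ∈ Ioo a b ∧ deriv v s < M := by
    have h1 : ∀ᶠ s in 𝓝 t, s ∈ Ioo a b ∧ deriv v s < M :=
      (isOpen_Ioo.eventually_mem ht).and
        ((hdc.continuousAt (isOpen_Ioo.mem_nhds ht)).eventually_lt_const hM1)
    obtain ⟨ρ, hρ, hρ'⟩ := Metric.eventually_nhds_iff.1 h1
    refine ⟨t - ρ / 2, t + ρ / 2, ⟨by linarith, by linarith⟩, fun s hs => hρ' ?_⟩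
    rw [Real.dist_eq, abs_lt]
    exact ⟨by linarith [hs.1], by linarith [hs.2]⟩
  have hc := (hce c ⟨le_rfl, (hte.1.trans hte.2).le⟩).1
  have he := (hce e ⟨(hte.1.trans hte.2).le, le_rfl⟩).1
  have hvc : v c < u x := hvt ▸ hmono (Ioo_subset_Icc_self hc) (Ioo_subset_Icc_self ht) hte.1
  have hve : u x < v e := hvt ▸ hmono (Ioo_subset_Icc_self ht) (Ioo_subset_Icc_self he) hte.2
  obtain ⟨κ, ⟨hκ0, hκ1⟩, hκM, hκc, hκe⟩ : ∃ κ ∈ Ioo (0 : ℝ) 1, M < κ * F (gradient u x) ∧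
      v c < κ * u x ∧ κ * u x < v e := by
    have hl : ∀ y : ℝ, Tendsto (fun κ : ℝ => κ * y) (𝓝[<] 1) (𝓝 y) := fun y => by
      have : Tendsto (fun κ : ℝ => κ * y) (𝓝 1) (𝓝 (1 * y)) := Continuous.tendsto (by fun_prop) 1
      rw [one_mul] at this
      exact this.mono_left nhdsWithin_le_nhds
    have h1 : ∀ᶠ κ in 𝓝[<] (1 : ℝ), κ ∈ Ioo (0 : ℝ) 1 := Ioo_mem_nhdsLT one_pos
    obtain ⟨κ, h⟩ := (h1.and (((hl _).eventually_const_lt hM2).and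
      (((hl _).eventually_const_lt hvc).and ((hl _).eventually_lt_const hve)))).exists
    exact ⟨κ, h⟩
  obtain ⟨p, ⟨hap, hpc⟩, hvp⟩ : ∃ p ∈ Ioo a c, v p < κ * v a := by
    have h1 : Tendsto v (𝓝[>] a) (𝓝 (v a)) :=
      ((hv.continuousOn a ⟨le_rfl, hab.le⟩).tendsto).mono_left
        (nhdsWithin_le_iff.2 (Icc_mem_nhdsGT hab))
    have h2 : ∀ᶠ s in 𝓝[>] a, s ∈ Ioo a c := Ioo_mem_nhdsGT hc.1
    obtain ⟨p, h⟩ := (h2.and (h1.eventually_lt_const (by nlinarith : v a < κ * v a))).exists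
    exact ⟨p, h⟩
  obtain ⟨q, ⟨heq, hqb⟩, hvq⟩ : ∃ q ∈ Ioo e b, κ * v b < v q := by
    have h1 : Tendsto v (𝓝[<] b) (𝓝 (v b)) :=
      ((hv.continuousOn b ⟨hab.le, le_rfl⟩).tendsto).mono_left
        (nhdsWithin_le_iff.2 (Icc_mem_nhdsLT hab))
    have h2 : ∀ᶠ s in 𝓝[<] b, s ∈ Ioo e b := Ioo_mem_nhdsLT he.2
    obtain ⟨q, h⟩ := (h2.and (h1.eventually_const_lt (by nlinarith : κ * v b < v b))).exists
    exact ⟨q, h⟩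
  have hce' : c < e := hte.1.trans hte.2
  obtain ⟨i, m, h, k, hh, hk, ε₁, hε₁, hbar⟩ := exists_perturbation hn hlam hT hv hode hv' hap
    (hpc.trans (hce'.trans heq)) hqb
  obtain ⟨ε₂, hε₂, hMk⟩ := exists_pos_add_mul_pos (a := fun s => M - deriv v s)
    (b := fun s => -k s) hce'.le
    (continuousOn_const.sub (hdc.mono fun s hs => (hce s hs).1))
    (hk.mono (Icc_subset_Icc hpc.le heq.le)).neg (fun s hs => sub_pos.2 (hce s hs).2)
  have hev : ∀ᶠ ε in 𝓝[>] (0 : ℝ), ε ∈ Ioc 0 (min ε₁ ε₂) := Ioc_mem_nhdsGT (lt_min hε₁ hε₂)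
  obtain ⟨ε, hε, hVp, hVq, hVc, hVe⟩ := (hev.and ((eventually_add_mul_lt (y := h p) hvp).and
    ((eventually_lt_add_mul (y := h q) hvq).and ((eventually_add_mul_lt (y := h c) hκc).and
      (eventually_lt_add_mul (y := h e) hκe))))).exists
  obtain ⟨V₂, ε₀, hB⟩ := hbar ε hε.1 (hε.2.trans (min_le_left _ _))
  have hκva : κ * v a < 0 := mul_neg_of_pos_of_neg hκ0 hva0
  have hκvb : 0 < κ * v b := mul_pos hκ0 hvb0
  obtain ⟨s, hs, hVs, hle⟩ := hB.gradient_le hne hbd hop hconv hsb hF hu hκ0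
    ⟨hVp.trans hκva, hκvb.trans hVq⟩ (fun z hz =>
      ⟨hVp.trans_le (mul_le_mul_of_nonneg_left (hrange z hz).1 hκ0.le),
        (mul_le_mul_of_nonneg_left (hrange z hz).2 hκ0.le).trans_lt hVq⟩) hx
  have hsc : c < s := by
    refine (hB.strictMonoOn.lt_iff_lt ⟨hpc.le, hce'.le.trans heq.le⟩
      (Ioo_subset_Icc_self hs)).1 ?_
    rwa [hVs]
  have hse : s < e := by
    refine (hB.strictMonoOn.lt_iff_lt (Ioo_subset_Icc_self hs)
      ⟨hpc.le.trans hce'.le, heq.le⟩).1 ?_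
    rwa [hVs]
  have := hMk ε hε.1 (hε.2.trans (min_le_right _ _)) s ⟨hsc.le, hse.le⟩
  linarith

end Main

end GradientComparison

/-- Gradient comparison with the one-dimensional model: if `v` solves
`v'' − Tv' = −λv` with Neumann conditions and `v' > 0`, `T = −(n−1)/t` or `T ≡ 0`,
and the range of `u` is contained in `[v(a), v(b)]`, then
`F(∇u(x)) ≤ v'(v⁻¹(u(x)))` on the closure of `Ω`. -/
theorem gradient_comparison {n : ℕ} (hn : 1 ≤ n)
    (Ω : Set (EuclideanSpace ℝ (Fin n))) (hne : Ω.Nonempty)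
    (hbd : Bornology.IsBounded Ω) (hop : IsOpen Ω) (hconv : Convex ℝ Ω)
    (hsb : HasSmoothBoundary Ω)
    (F : EuclideanSpace ℝ (Fin n) → ℝ) (hF : IsStronglyConvexMinkowskiNormC3 F)
    (lam : ℝ) (hlam : 0 < lam)
    (u : EuclideanSpace ℝ (Fin n) → ℝ)
    (hu : IsNeumannEigenfunction F Ω lam u)
    (hnc : ¬ ∃ c : ℝ, ∀ x ∈ closure Ω, u x = c)
    (hmean : ∫ x in Ω, u x = 0)
    (a b : ℝ) (hab : a < b) (T : ℝ → ℝ)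
    (hT : ((∀ t : ℝ, T t = -((n : ℝ) - 1) / t) ∧ 0 < a) ∨ (∀ t : ℝ, T t = 0))
    (v : ℝ → ℝ) (hv : ContDiffOn ℝ 2 v (Set.Icc a b))
    (hode : ∀ t ∈ Set.Ioo a b, deriv (deriv v) t - T t * deriv v t = -lam * v t)
    (hva : deriv v a = 0) (hvb : deriv v b = 0)
    (hv' : ∀ t ∈ Set.Ioo a b, 0 < deriv v t)
    (hrange : ∀ x ∈ closure Ω, v a ≤ u x ∧ u x ≤ v b) :
    ∀ x ∈ closure Ω, ∀ t ∈ Set.Icc a b, v t = u x →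
      F (gradient u x) ≤ deriv v t := by
  have huc := hu.contDiff1.continuousOn
  have hva0 : v a < 0 := by
    by_contra! h
    exact not_nonneg_of_integral_eq_zero hbd hop huc hnc hmean
      fun x hx => h.trans (hrange x hx).1
  have hvb0 : 0 < v b := by
    by_contra! h
    refine not_nonneg_of_integral_eq_zero (u := fun x => -u x) hbd hop huc.neg ?_ ?_
      fun x hx => neg_nonneg.2 ((hrange x hx).2.trans h)
    · rintro ⟨c, hc⟩
      exact hnc ⟨-c, fun x hx => by rw [← hc x hx, neg_neg]⟩
    · rw [MeasureTheory.integral_neg, hmean, neg_zero]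
  intro x hx t ht hvt
  rcases ht.1.eq_or_lt with rfl | hat
  · rw [hu.gradient_eq_zero_of_extremum hF hne hop hconv hx one_ne_zero fun z hz => by
      rw [one_mul, one_mul, ← hvt]; exact (hrange z hz).1, hF.map_zero, hva]
  rcases ht.2.eq_or_lt with rfl | htb
  · rw [hu.gradient_eq_zero_of_extremum hF hne hop hconv hx (neg_ne_zero.2 one_ne_zero)
      fun z hz => by linarith [(hrange z hz).2], hF.map_zero, hvb]
  exact gradient_comparison_interior hn hne hbd hop hconv hsb hF hlam hu hab hT hv hode hv'
    hrange hva0 hvb0 hx ⟨hat, htb⟩ hvt
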